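/- arXiv:2401.06190 — 2 statements merged into one kernel-verified Lean document; each statement's English description precedes it below -/
import Mathlib

section
/- Suppose that 1 < c < 82/79 and set γ = 1/c. For a positive integer N put P = 10⁻⁹ N^γ, D = log N, and Γ₂ = Σ_{d > D} μ(d) Σ_{P < p ≤ 2P} (log p) · #{m ∈ ℕ : d² ∣ m and [p^c] + [m^c] = N}, where p runs over primes and d over positive integers. Then there exists a constant C > 0 such that |Γ₂| ≤ C · N^{2γ−1} D^{−1} for all sufficiently large N. -/
/-- `P = 10⁻⁹ N^γ` where `γ = 1/c`. -/
noncomputable def PP (c : ℝ) (N : ℕ) : ℝ := ((10 : ℝ) ^ 9)⁻¹ * (N : ℝ) ^ (1 / c)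

/-- The primes `P < p ≤ 2P`.  (Any such prime satisfies `p ≤ N`, so the
range `Finset.range (N+1)` captures all of them.) -/
noncomputable def primesIn (c : ℝ) (N : ℕ) : Finset ℕ :=
  (Finset.range (N + 1)).filter
    (fun p => p.Prime ∧ PP c N < (p : ℝ) ∧ (p : ℝ) ≤ 2 * PP c N)

/-- `#{m ∈ ℕ : d² ∣ m and [p^c] + [m^c] = N}`. -/
noncomputable def cnt (c : ℝ) (N d p : ℕ) : ℕ :=
  {m : ℕ | 0 < m ∧ d ^ 2 ∣ m ∧ ⌊(p : ℝ) ^ c⌋ + ⌊(m : ℝ) ^ c⌋ = (N : ℤ)}.ncard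

/-- `Γ₂ = Σ_{d > D} μ(d) Σ_{P < p ≤ 2P} (log p) · #{m ∈ ℕ : d² ∣ m, [p^c]+[m^c]=N}`,
with `D = log N`; `d` runs over the positive integers exceeding `D`
(the sum has only finitely many nonzero terms). -/
noncomputable def Γ₂ (c : ℝ) (N : ℕ) : ℝ :=
  ∑' d : ℕ,
    if 0 < d ∧ Real.log N < (d : ℝ) then
      ((ArithmeticFunction.moebius d : ℤ) : ℝ) *
        ∑ p ∈ primesIn c N, Real.log p * (cnt c N d p : ℝ)
    else 0

open Finset ArithmeticFunction in
/-- Truncated sums of the Möbius function over `k ∣ q ∣ j`. -/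
theorem sum_moebius_div_between {R k j : ℕ} (hk : 1 ≤ k) (hj : 1 ≤ j) (hjR : j ≤ R) :
    ∑ q ∈ (Icc 1 R).filter (fun q => k ∣ q ∧ q ∣ j), ((moebius (j / q) : ℤ) : ℝ)
      = if j = k then 1 else 0 := by
  by_cases hkj : k ∣ j
  · obtain ⟨m, rfl⟩ := hkj
    have hm : 1 ≤ m := Nat.pos_of_ne_zero (by rintro rfl; simp at hj)
    have h1 : ∑ q ∈ (Icc 1 R).filter (fun q => k ∣ q ∧ q ∣ k * m), ((moebius (k * m / q) : ℤ) : ℝ)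
        = ∑ t ∈ m.divisors, ((moebius (m / t) : ℤ) : ℝ) := by
      symm
      refine Finset.sum_bij (fun t _ => k * t) ?_ ?_ ?_ ?_
      · intro t ht
        have htm := Nat.dvd_of_mem_divisors ht
        have ht0 := Nat.pos_of_mem_divisors ht
        simp only [mem_filter, mem_Icc]
        refine ⟨⟨Nat.mul_pos hk ht0, ?_⟩, Dvd.intro _ rfl, Nat.mul_dvd_mul_left _ htm⟩
        exact (Nat.mul_le_mul_left k (Nat.le_of_dvd hm htm)).trans hjR
      · intro a _ b _ hab
        exact Nat.eq_of_mul_eq_mul_left hk hab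
      · intro q hq
        simp only [mem_filter, mem_Icc] at hq
        obtain ⟨_, ⟨t, rfl⟩, h2⟩ := hq
        exact ⟨t, Nat.mem_divisors.2 ⟨Nat.dvd_of_mul_dvd_mul_left hk h2, by omega⟩, rfl⟩
      · intro t _
        rw [Nat.mul_div_mul_left _ _ hk]
    rw [h1, Nat.sum_div_divisors m (fun t => ((moebius t : ℤ) : ℝ)), ← Int.cast_sum,
      ← coe_mul_zeta_apply, moebius_mul_coe_zeta]
    rw [one_apply]
    have : k * m = k ↔ m = 1 := by
      constructor
      · intro h; exact Nat.eq_of_mul_eq_mul_left hk (by simpa using h)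
      · rintro rfl; simp
    simp [this]
  · rw [if_neg (by rintro rfl; exact hkj dvd_rfl), Finset.sum_eq_zero]
    intro q hq
    simp only [mem_filter] at hq
    exact absurd (hq.2.1.trans hq.2.2) hkj

open Finset ArithmeticFunction in
theorem log_le_two_mul_sum_moebius_sq_div (R : ℕ) :
    Real.log (R + 1) ≤ 2 * ∑ k ∈ Icc 1 R, ((moebius k : ℤ) : ℝ) ^ 2 / k := by
  have h0 : Real.log (R + 1) ≤ ∑ n ∈ Icc 1 R, (1 : ℝ) / n := by
    have := log_add_one_le_harmonic R
    rw [harmonic_eq_sum_Icc] at this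
    push_cast at this
    simpa using this
  refine h0.trans ?_
  have h1 : ∑ n ∈ Icc 1 R, (1 : ℝ) / n ≤ ∑ x ∈ Icc 1 R ×ˢ Icc 1 R,
      (1 / (x.1 : ℝ) ^ 2) * (((moebius x.2 : ℤ) : ℝ) ^ 2 / x.2) := by
    choose! a b hb ha hab hsq using
      fun n (hn : 0 < n) => Nat.sq_mul_squarefree_of_pos hn
    have hinj : Set.InjOn (fun n => (b n, a n)) (Icc 1 R : Finset ℕ) := by
      intro m hm n hn h
      simp only [coe_Icc, Set.mem_Icc, Prod.mk.injEq] at hm hn h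
      rw [← hab m hm.1, ← hab n hn.1, h.1, h.2]
    have hsub : (Icc 1 R).image (fun n => (b n, a n)) ⊆ Icc 1 R ×ˢ Icc 1 R := by
      intro x hx
      simp only [mem_image, mem_Icc] at hx
      obtain ⟨n, hn, rfl⟩ := hx
      have h := hab n hn.1
      have hb' := hb n hn.1
      have ha' := ha n hn.1
      have e1 : b n ≤ n := by
        nlinarith [Nat.mul_le_mul (Nat.le_self_pow two_ne_zero (b n)) ha']
      have e2 : a n ≤ n := by nlinarith [Nat.mul_le_mul_right (a n) (Nat.one_le_pow 2 (b n) ha')]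
      simp only [mem_product, mem_Icc]
      omega
    calc ∑ n ∈ Icc 1 R, (1 : ℝ) / n
        = ∑ n ∈ Icc 1 R, (1 / (b n : ℝ) ^ 2) * (((moebius (a n) : ℤ) : ℝ) ^ 2 / a n) := by
          refine Finset.sum_congr rfl fun n hn => ?_
          have hn1 := (mem_Icc.1 hn).1
          have h3 : ((moebius (a n) : ℤ) : ℝ) ^ 2 = 1 := by
            exact_mod_cast moebius_sq_eq_one_of_squarefree (hsq n hn1)
          have h4 : (n : ℝ) = (b n : ℝ) ^ 2 * a n := by exact_mod_cast (hab n hn1).symm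
          rw [h3, h4, div_mul_div_comm, one_mul]
      _ = ∑ x ∈ (Icc 1 R).image (fun n => (b n, a n)),
          (1 / (x.1 : ℝ) ^ 2) * (((moebius x.2 : ℤ) : ℝ) ^ 2 / x.2) := by
          rw [Finset.sum_image hinj]
      _ ≤ _ := Finset.sum_le_sum_of_subset_of_nonneg hsub fun _ _ _ => by positivity
  refine h1.trans ?_
  rw [Finset.sum_product]
  simp only
  rw [← Finset.sum_mul_sum]
  refine mul_le_mul_of_nonneg_right ?_ (Finset.sum_nonneg fun _ _ => by positivity)
  have h2 := sum_Ioo_inv_sq_le (α := ℝ) 0 (R + 1)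
  have h3 : Icc 1 R = Ioo 0 (R + 1) := by ext; simp; omega
  rw [h3]
  simpa using h2

open Finset ArithmeticFunction in
/-- Weights for the Selberg sieve of dimension one. -/
theorem exists_selberg_weights (R : ℕ) (hR : 1 ≤ R) :
    ∃ w : ℕ → ℝ, w 1 = 1 ∧ (∀ q ∈ Icc 1 R, |w q| ≤ (R : ℝ) ^ 2) ∧
      ∑ a ∈ Icc 1 R, ∑ b ∈ Icc 1 R, w a * w b / (Nat.lcm a b : ℝ) ≤ 2 / Real.log (R + 1) := by
  set S : ℝ := ∑ k ∈ Icc 1 R, ((moebius k : ℤ) : ℝ) ^ 2 / k with hS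
  have hlog : 0 < Real.log (R + 1) :=
    Real.log_pos (by have : (1 : ℝ) ≤ R := by exact_mod_cast hR
                     linarith)
  have hSlog := log_le_two_mul_sum_moebius_sq_div R
  rw [← hS] at hSlog
  have hS1 : 1 ≤ S := by
    have := Finset.single_le_sum (f := fun k : ℕ => ((moebius k : ℤ) : ℝ) ^ 2 / k)
      (fun k _ => by positivity) (mem_Icc.2 ⟨le_rfl, hR⟩ : 1 ∈ Icc 1 R)
    simpa using this
  set y : ℕ → ℝ := fun k => ((moebius k : ℤ) : ℝ) / (k * S) with hy
  set w : ℕ → ℝ := fun q => q * ∑ j ∈ (Icc 1 R).filter (fun j => q ∣ j),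
    ((moebius (j / q) : ℤ) : ℝ) * y j with hw
  have hmob : ∀ n : ℕ, |((moebius n : ℤ) : ℝ)| ≤ 1 := fun n => by
    exact_mod_cast (abs_moebius_le_one (n := n))
  have hdual : ∀ k ∈ Icc 1 R, ∑ q ∈ (Icc 1 R).filter (fun q => k ∣ q), w q / q = y k := by
    intro k hk
    rw [mem_Icc] at hk
    have e1 : ∀ q ∈ (Icc 1 R).filter (fun q => k ∣ q), w q / q
        = ∑ j ∈ Icc 1 R, if q ∣ j then ((moebius (j / q) : ℤ) : ℝ) * y j else 0 := by
      intro q hq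
      have : (q : ℝ) ≠ 0 := by
        have := (mem_Icc.1 (mem_filter.1 hq).1).1
        positivity
      simp only [hw]
      rw [mul_div_cancel_left₀ _ this, Finset.sum_filter]
    rw [Finset.sum_congr rfl e1, Finset.sum_comm]
    have e2 : ∀ j ∈ Icc 1 R, ∑ q ∈ (Icc 1 R).filter (fun q => k ∣ q),
        (if q ∣ j then ((moebius (j / q) : ℤ) : ℝ) * y j else 0) = if j = k then y j else 0 := by
      intro j hj
      rw [mem_Icc] at hj
      rw [← Finset.sum_filter, Finset.filter_filter, ← Finset.sum_mul,
        sum_moebius_div_between hk.1 hj.1 hj.2]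
      split_ifs <;> simp
    rw [Finset.sum_congr rfl e2, Finset.sum_ite_eq' (Icc 1 R) k y, if_pos (mem_Icc.2 hk)]
  refine ⟨w, ?_, ?_, ?_⟩
  · have : ∀ j ∈ Icc 1 R, ((moebius j : ℤ) : ℝ) * y j = ((moebius j : ℤ) : ℝ) ^ 2 / j / S := by
      intro j _
      simp only [hy]
      rw [div_div]; ring
    simp only [hw, Nat.cast_one, one_mul, one_dvd, Finset.filter_true, Nat.div_one]
    rw [Finset.sum_congr rfl this, ← Finset.sum_div, ← hS, div_self (by positivity)]
  · intro q hq
    rw [mem_Icc] at hq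
    have hyb : ∀ j ∈ Icc 1 R, |y j| ≤ 1 := by
      intro j hj
      have hj1 : (1 : ℝ) ≤ j := by exact_mod_cast (mem_Icc.1 hj).1
      have : (1 : ℝ) ≤ j * S := one_le_mul_of_one_le_of_one_le hj1 hS1
      simp only [hy]
      rw [abs_div, abs_of_pos (by positivity : (0 : ℝ) < j * S)]
      exact (div_le_one (by positivity)).2 ((hmob j).trans this)
    have hq' : (q : ℝ) ≤ R := by exact_mod_cast hq.2
    simp only [hw]
    rw [abs_mul, Nat.abs_cast, sq]
    refine mul_le_mul hq' ?_ (abs_nonneg _) (by positivity)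
    refine (Finset.abs_sum_le_sum_abs _ _).trans ?_
    calc ∑ j ∈ (Icc 1 R).filter (fun j => q ∣ j), |((moebius (j / q) : ℤ) : ℝ) * y j|
        ≤ ∑ j ∈ (Icc 1 R).filter (fun j => q ∣ j), (1 : ℝ) := by
          refine Finset.sum_le_sum fun j hj => ?_
          rw [abs_mul]
          exact mul_le_one₀ (hmob _) (abs_nonneg _) (hyb j (mem_filter.1 hj).1)
      _ ≤ ∑ j ∈ Icc 1 R, (1 : ℝ) :=
          Finset.sum_le_sum_of_subset_of_nonneg (Finset.filter_subset _ _) fun _ _ _ => by simp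
      _ = R := by simp
  · have hdiag : ∑ a ∈ Icc 1 R, ∑ b ∈ Icc 1 R, w a * w b / (Nat.lcm a b : ℝ)
        = ∑ k ∈ Icc 1 R, (k.totient : ℝ) * y k ^ 2 := by
      have e1 : ∀ a ∈ Icc 1 R, ∀ b ∈ Icc 1 R, w a * w b / (Nat.lcm a b : ℝ)
          = ∑ k ∈ Icc 1 R, (k.totient : ℝ) *
            ((if k ∣ a then w a / a else 0) * (if k ∣ b then w b / b else 0)) := by
        intro a ha b hb
        rw [mem_Icc] at ha hb
        have hg : 0 < Nat.gcd a b := Nat.gcd_pos_of_pos_left _ ha.1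
        have hgs : (Nat.gcd a b : ℝ) = ∑ k ∈ (Icc 1 R).filter (fun k => k ∣ a ∧ k ∣ b),
            (k.totient : ℝ) := by
          rw [← Nat.cast_sum, ← Nat.sum_totient (Nat.gcd a b)]
          congr 1
          refine Finset.sum_congr ?_ fun _ _ => rfl
          ext k
          simp only [Nat.mem_divisors, mem_filter, mem_Icc, Nat.dvd_gcd_iff]
          constructor
          · rintro ⟨h, -⟩
            exact ⟨⟨Nat.pos_of_dvd_of_pos h.1 ha.1, (Nat.le_of_dvd ha.1 h.1).trans ha.2⟩, h⟩
          · rintro ⟨-, h⟩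
            exact ⟨h, hg.ne'⟩
        have hl : (Nat.gcd a b : ℝ) * Nat.lcm a b = a * b := by
          exact_mod_cast Nat.gcd_mul_lcm a b
        have ha0 : (a : ℝ) ≠ 0 := by have := ha.1; positivity
        have hb0 : (b : ℝ) ≠ 0 := by have := hb.1; positivity
        have hl0 : (Nat.lcm a b : ℝ) ≠ 0 := by
          intro h; rw [h, mul_zero] at hl; exact mul_ne_zero ha0 hb0 hl.symm
        have e : w a * w b / (Nat.lcm a b : ℝ)
            = (Nat.gcd a b : ℝ) * ((w a / a) * (w b / b)) := by
          field_simp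
          linear_combination (-(w a * w b)) * hl
        rw [e, hgs, Finset.sum_mul, Finset.sum_filter]
        refine Finset.sum_congr rfl fun k _ => ?_
        by_cases h1 : k ∣ a <;> by_cases h2 : k ∣ b <;> simp [h1, h2]
      rw [Finset.sum_congr rfl fun a ha => Finset.sum_congr rfl (e1 a ha)]
      rw [Finset.sum_congr rfl fun a _ => Finset.sum_comm, Finset.sum_comm]
      refine Finset.sum_congr rfl fun k hk => ?_
      rw [← hdual k hk, sq, Finset.sum_filter, Finset.sum_mul_sum, Finset.mul_sum]
      refine Finset.sum_congr rfl fun a _ => ?_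
      rw [Finset.mul_sum]
    rw [hdiag]
    calc ∑ k ∈ Icc 1 R, (k.totient : ℝ) * y k ^ 2
        ≤ ∑ k ∈ Icc 1 R, ((moebius k : ℤ) : ℝ) ^ 2 / k / S ^ 2 := by
          refine Finset.sum_le_sum fun k hk => ?_
          have hk1 : (1 : ℝ) ≤ k := by exact_mod_cast (mem_Icc.1 hk).1
          have ht : (k.totient : ℝ) ≤ k := by exact_mod_cast Nat.totient_le k
          calc (k.totient : ℝ) * y k ^ 2 ≤ k * y k ^ 2 :=
                mul_le_mul_of_nonneg_right ht (sq_nonneg _)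
            _ = _ := by simp only [hy]; field_simp
      _ = 1 / S := by rw [← Finset.sum_div, ← hS]; field_simp
      _ ≤ 2 / Real.log (R + 1) := by
          rw [div_le_div_iff₀ (by positivity) hlog]; linarith
/-- The additive character `x ↦ e^{2πix}`. -/
noncomputable def addExp (x : ℝ) : ℂ := Complex.exp ((2 * Real.pi * x : ℝ) * Complex.I)

theorem norm_addExp (x : ℝ) : ‖addExp x‖ = 1 := Complex.norm_exp_ofReal_mul_I _

theorem addExp_add (x y : ℝ) : addExp (x + y) = addExp x * addExp y := by
  unfold addExp
  rw [← Complex.exp_add]; congr 1; push_cast; ring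

theorem addExp_zero : addExp 0 = 1 := by simp [addExp]

theorem addExp_intCast (n : ℤ) : addExp n = 1 := by
  unfold addExp
  rw [Complex.exp_eq_one_iff]
  exact ⟨n, by push_cast; ring⟩

theorem addExp_neg (x : ℝ) : addExp (-x) = (starRingEnd ℂ) (addExp x) := by
  unfold addExp
  rw [← Complex.exp_conj, map_mul, Complex.conj_I, Complex.conj_ofReal]
  congr 1; push_cast; ring

theorem addExp_re (x : ℝ) : (addExp x).re = Real.cos (2 * Real.pi * x) := by
  unfold addExp
  exact Complex.exp_ofReal_mul_I_re _

theorem norm_one_sub_addExp_le (x : ℝ) : ‖1 - addExp x‖ ≤ 7 * |x| := by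
  rw [norm_sub_rev]
  have h := Real.norm_exp_I_mul_ofReal_sub_one_le (x := 2 * Real.pi * x)
  have h2 : addExp x = Complex.exp (Complex.I * (2 * Real.pi * x : ℝ)) := by
    unfold addExp; rw [mul_comm]
  rw [h2]
  refine h.trans ?_
  rw [Real.norm_eq_abs, abs_mul, abs_of_pos (by positivity)]
  have := Real.pi_lt_d2
  exact mul_le_mul_of_nonneg_right (by linarith) (abs_nonneg _)

theorem norm_addExp_sub_addExp_le (x y : ℝ) : ‖addExp x - addExp y‖ ≤ 7 * |x - y| := by
  have h : addExp x - addExp y = -(addExp y * (1 - addExp (x - y))) := by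
    rw [mul_sub, ← addExp_add]; simp
  rw [h, norm_neg, norm_mul, norm_addExp, one_mul]
  exact norm_one_sub_addExp_le _

theorem abs_sub_round_le_norm_one_sub_addExp (x : ℝ) :
    |x - round x| ≤ ‖1 - addExp x‖ := by
  set t := x - round x with ht
  have h1 : addExp x = addExp t := by
    have : x = t + ((round x : ℤ) : ℝ) := by rw [ht]; ring
    conv_lhs => rw [this]
    rw [addExp_add, addExp_intCast, mul_one]
  have ht2 : |t| ≤ 1 / 2 := abs_sub_round x
  rw [h1, norm_sub_rev]
  have h2 : addExp t = Complex.exp (Complex.I * (2 * Real.pi * t : ℝ)) := by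
    unfold addExp; rw [mul_comm]
  rw [h2, Complex.norm_exp_I_mul_ofReal_sub_one]
  rw [norm_mul, Real.norm_eq_abs, Real.norm_eq_abs, abs_two]
  have h3 : 2 * Real.pi * t / 2 = Real.pi * t := by ring
  rw [h3]
  have h4 := Real.mul_abs_le_abs_sin (x := Real.pi * t) (by
    rw [abs_mul, abs_of_pos Real.pi_pos]; nlinarith [Real.pi_pos])
  rw [abs_mul, abs_of_pos Real.pi_pos] at h4
  have h5 : 2 / Real.pi * (Real.pi * |t|) = 2 * |t| := by
    field_simp
  rw [h5] at h4
  linarith [abs_nonneg t]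

/-- Fejér-type detection of points close to an integer. -/
theorem sq_div_four_le_norm_sum_addExp_sq {H : ℕ} {x : ℝ} {k : ℤ}
    (hx : |x - k| * (6 * H) ≤ 1) :
    (H : ℝ) ^ 2 / 4 ≤ ‖∑ j ∈ Finset.range H, addExp (j * x)‖ ^ 2 := by
  have h1 : ∀ j ∈ Finset.range H, 1 / 2 ≤ (addExp (j * x)).re := by
    intro j hj
    have hjH : (j : ℝ) ≤ H := by exact_mod_cast (Finset.mem_range.1 hj).le
    have e : addExp (j * x) = addExp (j * (x - k)) := by
      have : (j : ℝ) * x = j * (x - k) + ((j * k : ℤ) : ℝ) := by push_cast; ring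
      rw [this, addExp_add, addExp_intCast, mul_one]
    rw [e, addExp_re, ← Real.cos_abs, ← Real.cos_pi_div_three]
    have h2 : |2 * Real.pi * (j * (x - k))| ≤ Real.pi / 3 := by
      rw [abs_mul, abs_mul (j : ℝ), Nat.abs_cast, abs_of_pos (by positivity : 0 < 2 * Real.pi)]
      have : (j : ℝ) * |x - k| ≤ 1 / 6 := by
        have := mul_le_mul_of_nonneg_right hjH (abs_nonneg (x - k))
        linarith
      nlinarith [Real.pi_pos]
    exact Real.cos_le_cos_of_nonneg_of_le_pi (abs_nonneg _) (by linarith [Real.pi_pos]) h2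
  have h3 : (H : ℝ) / 2 ≤ ‖∑ j ∈ Finset.range H, addExp (j * x)‖ := by
    refine le_trans ?_ (Complex.re_le_norm _)
    rw [Complex.re_sum]
    have := Finset.card_nsmul_le_sum (Finset.range H) (fun j => (addExp (j * x)).re) (1 / 2) h1
    simp only [Finset.card_range, nsmul_eq_mul] at this
    linarith
  calc (H : ℝ) ^ 2 / 4 = (H / 2) ^ 2 := by ring
    _ ≤ _ := by gcongr

/-- Counting values of a slowly increasing, well-spaced sequence near integers. -/
theorem card_near_integers_le {g : ℕ → ℝ} {K : ℕ} {lam mu Δ : ℝ} (hlam : 0 < lam)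
    (hmu : 0 ≤ mu) (hΔ0 : 0 < Δ)
    (h1 : ∀ n, n + 1 < K → lam ≤ g (n + 1) - g n) (h2 : ∀ n, n + 1 < K → g (n + 1) - g n ≤ mu) :
    (((Finset.range K).filter (fun n => |g n - round (g n)| < Δ)).card : ℝ)
      ≤ (K * mu + 3) * (2 * Δ / lam + 1) := by
  classical
  rcases Nat.eq_zero_or_pos K with rfl | hK
  · simp; positivity
  have hgap : ∀ k, ∀ n, n + k < K → lam * k ≤ g (n + k) - g n ∧ g (n + k) - g n ≤ mu * k := by
    intro k
    induction k with
    | zero => intro n _; simp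
    | succ k ih =>
      intro n hn
      have a := ih n (by omega)
      have b := h1 (n + k) (by omega)
      have b' := h2 (n + k) (by omega)
      push_cast
      rw [← add_assoc]
      constructor <;> linarith [a.1, a.2]
  have hmono : ∀ m n, m ≤ n → n < K → lam * ((n : ℝ) - m) ≤ g n - g m := by
    intro m n hmn hn
    have := (hgap (n - m) m (by omega)).1
    rw [Nat.add_sub_cancel' hmn, Nat.cast_sub hmn] at this
    exact this
  have hlast := (hgap (K - 1) 0 (by omega)).2
  rw [zero_add] at hlast
  set s := (Finset.range K).filter (fun n => |g n - round (g n)| < Δ) with hs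
  have hsub : s.image (fun n => round (g n)) ⊆ Finset.Icc (round (g 0)) (round (g (K - 1))) := by
    intro b hb
    obtain ⟨n, hn, rfl⟩ := Finset.mem_image.1 hb
    have hnK := Finset.mem_range.1 (Finset.mem_filter.1 hn).1
    have e1 := hmono 0 n (Nat.zero_le _) hnK
    have e2 := hmono n (K - 1) (by omega) (by omega)
    have e3 : (n : ℝ) ≤ ((K - 1 : ℕ) : ℝ) := by exact_mod_cast (by omega : n ≤ K - 1)
    have e4 : g 0 ≤ g n := by
      have : 0 ≤ lam * ((n : ℝ) - (0 : ℕ)) := mul_nonneg hlam.le (by simp)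
      linarith
    have e5 : g n ≤ g (K - 1) := by
      have : 0 ≤ lam * (((K - 1 : ℕ) : ℝ) - n) := mul_nonneg hlam.le (by linarith)
      linarith
    rw [Finset.mem_Icc, round_eq, round_eq, round_eq]
    exact ⟨Int.floor_le_floor (by linarith), Int.floor_le_floor (by linarith)⟩
  have hfib : ∀ b ∈ s.image (fun n => round (g n)),
      (s.filter (fun n => round (g n) = b)).card ≤ ⌊2 * Δ / lam⌋₊ + 1 := by
    intro b hb
    set t := s.filter (fun n => round (g n) = b) with ht
    have htne : t.Nonempty := by
      obtain ⟨n, hn, rfl⟩ := Finset.mem_image.1 hb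
      exact ⟨n, Finset.mem_filter.2 ⟨hn, rfl⟩⟩
    have hsubt : t ⊆ Finset.Icc (t.min' htne) (t.min' htne + ⌊2 * Δ / lam⌋₊) := by
      intro n hn
      have hmin := t.min'_le n hn
      have hm := t.min'_mem htne
      set m := t.min' htne
      rw [Finset.mem_Icc]
      refine ⟨hmin, ?_⟩
      simp only [ht, hs, Finset.mem_filter, Finset.mem_range] at hn hm
      have h3 := hmono m n hmin hn.1.1
      have h4 := hn.1.2
      have h5 := hm.1.2
      rw [hn.2, abs_lt] at h4
      rw [hm.2, abs_lt] at h5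
      have h6 : ((n - m : ℕ) : ℝ) ≤ 2 * Δ / lam := by
        rw [Nat.cast_sub hmin, le_div_iff₀ hlam]
        linarith [h4.2, h5.1]
      have := Nat.le_floor h6
      omega
    have := Finset.card_le_card hsubt
    simp only [Nat.card_Icc] at this
    omega
  have hcard := Finset.card_le_mul_card_image s _ hfib
  have hF : ((⌊2 * Δ / lam⌋₊ + 1 : ℕ) : ℝ) ≤ 2 * Δ / lam + 1 := by
    push_cast
    linarith [Nat.floor_le (by positivity : 0 ≤ 2 * Δ / lam)]
  have hI : ((s.image (fun n => round (g n))).card : ℝ) ≤ K * mu + 3 := by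
    have h3 := Finset.card_le_card hsub
    rw [Int.card_Icc] at h3
    have e1 := abs_sub_round (g 0)
    have e2 := abs_sub_round (g (K - 1))
    rw [abs_le] at e1 e2
    have e3 : mu * ((K - 1 : ℕ) : ℝ) ≤ K * mu := by
      rw [mul_comm]
      exact mul_le_mul_of_nonneg_right (by exact_mod_cast Nat.sub_le K 1) hmu
    have e4 : (((s.image (fun n => round (g n))).card : ℤ) : ℝ)
        ≤ ((max (round (g (K - 1)) + 1 - round (g 0)) 0 : ℤ) : ℝ) := by
      rw [← Int.toNat_eq_max]; exact_mod_cast h3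
    push_cast at e4
    refine e4.trans (max_le ?_ (by positivity))
    linarith [e1.1, e1.2, e2.1, e2.2]
  calc (s.card : ℝ)
      ≤ ((⌊2 * Δ / lam⌋₊ + 1 : ℕ) : ℝ) * ((s.image (fun n => round (g n))).card : ℝ) := by
        exact_mod_cast hcard
    _ ≤ (2 * Δ / lam + 1) * (K * mu + 3) := by gcongr
    _ = _ := by ring


theorem norm_regularized_inv_sub_le {ε : ℝ} (hε : 0 < ε) (a b : ℂ) :
    ‖(starRingEnd ℂ) a / ((‖a‖ ^ 2 + ε : ℝ) : ℂ) - (starRingEnd ℂ) b / ((‖b‖ ^ 2 + ε : ℝ) : ℂ)‖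
      ≤ ‖a - b‖ / ε := by
  have ha : 0 < ‖a‖ ^ 2 + ε := by positivity
  have hb : 0 < ‖b‖ ^ 2 + ε := by positivity
  have ha' : ((‖a‖ ^ 2 + ε : ℝ) : ℂ) ≠ 0 := by exact_mod_cast ha.ne'
  have hb' : ((‖b‖ ^ 2 + ε : ℝ) : ℂ) ≠ 0 := by exact_mod_cast hb.ne'
  have e : (starRingEnd ℂ) a / ((‖a‖ ^ 2 + ε : ℝ) : ℂ) - (starRingEnd ℂ) b / ((‖b‖ ^ 2 + ε : ℝ) : ℂ)
      = (ε * (starRingEnd ℂ) (a - b) - (starRingEnd ℂ) a * (starRingEnd ℂ) b * (a - b)) /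
        (((‖a‖ ^ 2 + ε : ℝ) : ℂ) * ((‖b‖ ^ 2 + ε : ℝ) : ℂ)) := by
    rw [div_sub_div _ _ ha' hb']
    congr 1
    have h1 : ((‖a‖ : ℂ)) ^ 2 = a * (starRingEnd ℂ) a := (Complex.mul_conj' a).symm
    have h2 : ((‖b‖ : ℂ)) ^ 2 = b * (starRingEnd ℂ) b := (Complex.mul_conj' b).symm
    push_cast
    rw [h1, h2, map_sub]
    ring
  rw [e, norm_div, norm_mul, Complex.norm_real, Complex.norm_real, Real.norm_of_nonneg ha.le,
    Real.norm_of_nonneg hb.le]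
  have h3 : ‖(ε : ℂ) * (starRingEnd ℂ) (a - b) - (starRingEnd ℂ) a * (starRingEnd ℂ) b * (a - b)‖
      ≤ (ε + ‖a‖ * ‖b‖) * ‖a - b‖ := by
    refine (norm_sub_le _ _).trans ?_
    simp only [norm_mul, RCLike.norm_conj, Complex.norm_real, Real.norm_of_nonneg hε.le]
    linarith
  rw [div_le_div_iff₀ (by positivity) hε]
  have h4 : (ε + ‖a‖ * ‖b‖) * ε ≤ (‖a‖ ^ 2 + ε) * (‖b‖ ^ 2 + ε) := by
    have : 0 ≤ ε * (‖a‖ - ‖b‖) ^ 2 := by positivity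
    have : 0 ≤ ε * ‖a‖ ^ 2 := by positivity
    have : 0 ≤ ε * ‖b‖ ^ 2 := by positivity
    have : 0 ≤ ‖a‖ ^ 2 * ‖b‖ ^ 2 := by positivity
    nlinarith
  calc _ ≤ (ε + ‖a‖ * ‖b‖) * ‖a - b‖ * ε := by gcongr
    _ = ‖a - b‖ * ((ε + ‖a‖ * ‖b‖) * ε) := by ring
    _ ≤ _ := by gcongr

/-- A van der Corput type bound for exponential sums with second differences in `[lam, mu]`. -/
theorem norm_sum_addExp_le {f : ℕ → ℝ} {K : ℕ} {lam mu Δ : ℝ} (hlam : 0 < lam)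
    (hmu : 0 ≤ mu) (hΔ0 : 0 < Δ)
    (h1 : ∀ n, n + 1 < K → lam ≤ f (n + 2) - 2 * f (n + 1) + f n)
    (h2 : ∀ n, n + 1 < K → f (n + 2) - 2 * f (n + 1) + f n ≤ mu) :
    ‖∑ n ∈ Finset.range K, addExp (f n)‖ ≤
      K * Δ + (K * mu + 3) * (2 * Δ / lam + 1) + (4 + 7 * (K * mu)) / Δ ^ 3 := by
  rcases Nat.eq_zero_or_pos K with rfl | hK
  · simp; positivity
  set ε := Δ ^ 3 with hε
  have hε0 : 0 < ε := by positivity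
  set g : ℕ → ℝ := fun n => f (n + 1) - f n with hg
  set w : ℕ → ℂ := fun n => 1 - addExp (g n) with hw
  set u : ℕ → ℂ := fun n => (starRingEnd ℂ) (w n) / ((‖w n‖ ^ 2 + ε : ℝ) : ℂ) with hu
  have hw2 : ∀ n, ‖w n‖ ≤ 2 := fun n => by
    refine (norm_sub_le _ _).trans ?_
    rw [norm_addExp, norm_one]; norm_num
  have hu2 : ∀ n, ‖u n‖ ≤ 2 / ε := fun n => by
    simp only [hu]
    rw [norm_div, RCLike.norm_conj, Complex.norm_real, Real.norm_of_nonneg (by positivity)]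
    exact div_le_div₀ (by norm_num) (hw2 n) hε0 (by nlinarith [sq_nonneg ‖w n‖])
  have hsplit : ∀ n, addExp (f n) = (addExp (f n) - addExp (f (n + 1))) * u n +
      addExp (f n) * ((ε / (‖w n‖ ^ 2 + ε) : ℝ) : ℂ) := by
    intro n
    have e1 : addExp (f (n + 1)) = addExp (f n) * addExp (g n) := by
      rw [← addExp_add]; congr 1; simp only [hg]; ring
    have e2 : addExp (f n) - addExp (f (n + 1)) = addExp (f n) * w n := by
      rw [e1]; simp only [hw]; ring
    have e3 : w n * u n + ((ε / (‖w n‖ ^ 2 + ε) : ℝ) : ℂ) = 1 := by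
      have hne : ((‖w n‖ ^ 2 + ε : ℝ) : ℂ) ≠ 0 := by
        exact_mod_cast (by positivity : ‖w n‖ ^ 2 + ε ≠ 0)
      simp only [hu]
      rw [← mul_div_assoc, Complex.mul_conj', Complex.ofReal_div, ← add_div, div_eq_one_iff_eq hne]
      push_cast; ring
    rw [e2, mul_assoc, ← mul_add, e3, mul_one]
  have htel : ∀ M : ℕ, ‖∑ n ∈ Finset.range M, (addExp (f n) - addExp (f (n + 1))) * u n
      + addExp (f M) * u (M - 1) - addExp (f 0) * u 0‖ ≤
      ∑ n ∈ Finset.range (M - 1), ‖u (n + 1) - u n‖ := by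
    intro M
    induction M with
    | zero => simp
    | succ M ih =>
      rcases Nat.eq_zero_or_pos M with rfl | hM
      · simp only [zero_add, Finset.sum_range_one, Nat.sub_self, Finset.range_zero,
          Finset.sum_empty]
        rw [show (addExp (f 0) - addExp (f 1)) * u 0 + addExp (f 1) * u 0 - addExp (f 0) * u 0
          = 0 by ring, norm_zero]
      · obtain ⟨k, rfl⟩ : ∃ k, M = k + 1 := ⟨M - 1, by omega⟩
        simp only [Nat.add_sub_cancel] at ih ⊢
        rw [Finset.sum_range_succ, Finset.sum_range_succ (fun n => ‖u (n + 1) - u n‖)]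
        have e : ∑ n ∈ Finset.range (k + 1), (addExp (f n) - addExp (f (n + 1))) * u n
            + (addExp (f (k + 1)) - addExp (f (k + 1 + 1))) * u (k + 1)
            + addExp (f (k + 1 + 1)) * u (k + 1) - addExp (f 0) * u 0
            = (∑ n ∈ Finset.range (k + 1), (addExp (f n) - addExp (f (n + 1))) * u n
            + addExp (f (k + 1)) * u k - addExp (f 0) * u 0)
            + addExp (f (k + 1)) * (u (k + 1) - u k) := by ring
        rw [e]
        refine (norm_add_le _ _).trans (add_le_add ih ?_)
        rw [norm_mul, norm_addExp, one_mul]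
  have hg1 : ∀ n, n + 1 < K → lam ≤ g (n + 1) - g n := fun n hn => by
    have := h1 n hn; simp only [hg]; linarith
  have hg2 : ∀ n, n + 1 < K → g (n + 1) - g n ≤ mu := fun n hn => by
    have := h2 n hn; simp only [hg]; linarith
  have hvar : ∑ n ∈ Finset.range (K - 1), ‖u (n + 1) - u n‖ ≤ 7 * (K * mu) / ε := by
    have e1 : ∀ n ∈ Finset.range (K - 1), ‖u (n + 1) - u n‖ ≤ 7 * mu / ε := by
      intro n hn
      have hn' : n + 1 < K := by have := Finset.mem_range.1 hn; omega
      refine (norm_regularized_inv_sub_le hε0 _ _).trans ?_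
      gcongr
      have e2 : w (n + 1) - w n = addExp (g n) - addExp (g (n + 1)) := by
        simp only [hw]; ring
      rw [e2]
      refine (norm_addExp_sub_addExp_le _ _).trans ?_
      rw [abs_sub_comm, abs_of_nonneg (hlam.le.trans (hg1 n hn'))]
      linarith [hg2 n hn']
    refine (Finset.sum_le_card_nsmul _ _ _ e1).trans ?_
    rw [Finset.card_range, nsmul_eq_mul]
    have : ((K - 1 : ℕ) : ℝ) ≤ K := by exact_mod_cast Nat.sub_le K 1
    calc ((K - 1 : ℕ) : ℝ) * (7 * mu / ε) ≤ K * (7 * mu / ε) := by gcongr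
      _ = _ := by ring
  have hmain : ‖∑ n ∈ Finset.range K, (addExp (f n) - addExp (f (n + 1))) * u n‖
      ≤ (4 + 7 * (K * mu)) / ε := by
    have e := (htel K).trans hvar
    have e2 : ∑ n ∈ Finset.range K, (addExp (f n) - addExp (f (n + 1))) * u n
        = (∑ n ∈ Finset.range K, (addExp (f n) - addExp (f (n + 1))) * u n
      + addExp (f K) * u (K - 1) - addExp (f 0) * u 0) - addExp (f K) * u (K - 1)
        + addExp (f 0) * u 0 := by ring
    rw [e2]
    refine (norm_add_le _ _).trans ?_
    refine (add_le_add_left (norm_sub_le _ _) _).trans ?_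
    rw [norm_mul, norm_mul, norm_addExp, norm_addExp, one_mul, one_mul]
    have e3 := hu2 0
    have e4 := hu2 (K - 1)
    calc _ ≤ 7 * (K * mu) / ε + 2 / ε + 2 / ε := by gcongr
      _ = _ := by ring
  have hres : ‖∑ n ∈ Finset.range K, addExp (f n) * ((ε / (‖w n‖ ^ 2 + ε) : ℝ) : ℂ)‖
      ≤ K * Δ + (K * mu + 3) * (2 * Δ / lam + 1) := by
    refine (norm_sum_le _ _).trans ?_
    have e1 : ∀ n ∈ Finset.range K, ‖addExp (f n) * ((ε / (‖w n‖ ^ 2 + ε) : ℝ) : ℂ)‖ ≤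
        Δ + if |g n - round (g n)| < Δ then 1 else 0 := by
      intro n _
      rw [norm_mul, norm_addExp, one_mul, Complex.norm_real, Real.norm_of_nonneg (by positivity)]
      split_ifs with h
      · have : ε / (‖w n‖ ^ 2 + ε) ≤ 1 :=
          (div_le_one (by positivity)).2 (by nlinarith [sq_nonneg ‖w n‖])
        linarith
      · have h3 : Δ ≤ ‖w n‖ := (not_lt.1 h).trans (abs_sub_round_le_norm_one_sub_addExp _)
        rw [add_zero, div_le_iff₀ (by positivity), hε]
        have : Δ ^ 2 ≤ ‖w n‖ ^ 2 := by gcongr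
        have := mul_le_mul_of_nonneg_left this hΔ0.le
        have : 0 ≤ Δ * Δ ^ 3 := by positivity
        nlinarith
    refine (Finset.sum_le_sum e1).trans ?_
    rw [Finset.sum_add_distrib, Finset.sum_const, Finset.card_range, nsmul_eq_mul,
      Finset.sum_boole]
    gcongr
    exact card_near_integers_le hlam hmu hΔ0 hg1 hg2
  rw [Finset.sum_congr rfl fun n _ => hsplit n, Finset.sum_add_distrib]
  refine (norm_add_le _ _).trans ?_
  linarith

theorem Ioc_filter_dvd_eq_image {A B r : ℕ} (hr : 0 < r) :
    (Finset.Ioc A B).filter (fun n => r ∣ n) =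
      (Finset.Ioc (A / r) (B / r)).image (fun l => r * l) := by
  ext n
  simp only [Finset.mem_filter, Finset.mem_Ioc, Finset.mem_image]
  constructor
  · rintro ⟨⟨h1, h2⟩, l, rfl⟩
    refine ⟨l, ⟨?_, ?_⟩, rfl⟩
    · rw [Nat.div_lt_iff_lt_mul hr, mul_comm]; exact h1
    · rw [Nat.le_div_iff_mul_le hr, mul_comm]; exact h2
  · rintro ⟨l, ⟨h1, h2⟩, rfl⟩
    rw [Nat.div_lt_iff_lt_mul hr, mul_comm] at h1
    rw [Nat.le_div_iff_mul_le hr, mul_comm] at h2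
    exact ⟨⟨h1, h2⟩, Dvd.intro _ rfl⟩

theorem sum_Ioc_filter_dvd {M : Type*} [AddCommMonoid M] {A B r : ℕ} (hr : 0 < r) (f : ℕ → M) :
    ∑ n ∈ (Finset.Ioc A B).filter (fun n => r ∣ n), f n =
      ∑ i ∈ Finset.range (B / r - A / r), f (r * (A / r + 1 + i)) := by
  rw [Ioc_filter_dvd_eq_image hr, Finset.sum_image fun a _ b _ h => Nat.eq_of_mul_eq_mul_left hr h,
    ← Finset.Ico_add_one_add_one_eq_Ioc, Finset.sum_Ico_eq_sum_range]
  rw [Nat.add_sub_add_right]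

theorem abs_card_Ioc_filter_dvd_sub_le {A B r : ℕ} (hAB : A ≤ B) (hr : 0 < r) :
    |(((Finset.Ioc A B).filter (fun n => r ∣ n)).card : ℝ) - ((B : ℝ) - A) / r| ≤ 1 := by
  have h : ((Finset.Ioc A B).filter (fun n => r ∣ n)).card = B / r - A / r := by
    rw [Finset.card_eq_sum_ones, sum_Ioc_filter_dvd hr]; simp
  rw [h, Nat.cast_sub (Nat.div_le_div_right hAB), sub_div]
  have hr' : (0 : ℝ) < r := by exact_mod_cast hr
  have a1 := Nat.cast_div_le (α := ℝ) (m := A) (n := r)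
  have a2 := Nat.cast_div_le (α := ℝ) (m := B) (n := r)
  have a3 : (A : ℝ) / r < (A / r : ℕ) + 1 := by
    rw [div_lt_iff₀ hr']; exact_mod_cast Nat.lt_mul_of_div_lt (Nat.lt_succ_self _) hr
  have a4 : (B : ℝ) / r < (B / r : ℕ) + 1 := by
    rw [div_lt_iff₀ hr']; exact_mod_cast Nat.lt_mul_of_div_lt (Nat.lt_succ_self _) hr
  rw [abs_le]
  constructor <;> linarith

theorem norm_sum_addExp_sq (H : ℕ) (x : ℝ) :
    ((‖∑ j ∈ Finset.range H, addExp (j * x)‖ ^ 2 : ℝ) : ℂ) =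
      ∑ i ∈ Finset.range H, ∑ j ∈ Finset.range H, addExp (((i : ℝ) - j) * x) := by
  rw [Complex.ofReal_pow, ← Complex.mul_conj', map_sum, Finset.sum_mul_sum]
  refine Finset.sum_congr rfl fun i _ => Finset.sum_congr rfl fun j _ => ?_
  rw [← addExp_neg, ← addExp_add]
  congr 1; ring

/-- Expansion of the second moment of a Dirichlet kernel along a sequence. -/
theorem abs_sum_norm_sum_addExp_sq_sub_le {s : Finset ℕ} {H : ℕ} {x : ℕ → ℝ} {E : ℝ} (hE0 : 0 ≤ E)
    (hE : ∀ j : ℕ, 1 ≤ j → j < H → ‖∑ n ∈ s, addExp (j * x n)‖ ≤ E) :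
    |∑ n ∈ s, ‖∑ j ∈ Finset.range H, addExp (j * x n)‖ ^ 2 - H * s.card| ≤ (H : ℝ) ^ 2 * E := by
  have hE' : ∀ i ∈ Finset.range H, ∀ j ∈ Finset.range H,
      ‖∑ n ∈ s, addExp (((i : ℝ) - j) * x n) - if i = j then (s.card : ℂ) else 0‖ ≤ E := by
    intro i hi j hj
    rw [Finset.mem_range] at hi hj
    rcases lt_trichotomy i j with h | rfl | h
    · rw [if_neg h.ne, sub_zero]
      have e : ∑ n ∈ s, addExp (((i : ℝ) - j) * x n)
          = (starRingEnd ℂ) (∑ n ∈ s, addExp (((j - i : ℕ) : ℝ) * x n)) := by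
        rw [map_sum]
        refine Finset.sum_congr rfl fun n _ => ?_
        rw [← addExp_neg, Nat.cast_sub h.le]
        congr 1; ring
      rw [e, RCLike.norm_conj]
      exact hE _ (by omega) (by omega)
    · simp [addExp_zero, hE0]
    · rw [if_neg h.ne', sub_zero, ← Nat.cast_sub h.le]
      exact hE _ (by omega) (by omega)
  have e : ((∑ n ∈ s, ‖∑ j ∈ Finset.range H, addExp (j * x n)‖ ^ 2 - H * s.card : ℝ) : ℂ)
      = ∑ i ∈ Finset.range H, ∑ j ∈ Finset.range H,
        (∑ n ∈ s, addExp (((i : ℝ) - j) * x n) - if i = j then (s.card : ℂ) else 0) := by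
    simp only [Finset.sum_sub_distrib, Finset.sum_ite_eq]
    rw [Complex.ofReal_sub, Complex.ofReal_sum]
    congr 1
    · rw [Finset.sum_congr rfl fun n _ => norm_sum_addExp_sq H (x n), Finset.sum_comm]
      exact Finset.sum_congr rfl fun i _ => Finset.sum_comm
    · rw [Finset.sum_congr rfl fun i hi => if_pos hi]
      simp
  rw [← Real.norm_eq_abs, ← Complex.norm_real, e]
  refine (norm_sum_le_of_le _ fun i hi => norm_sum_le_of_le _ (hE' i hi)).trans ?_
  simp only [Finset.sum_const, Finset.card_range, nsmul_eq_mul]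
  rw [sq, mul_assoc]

/-- Selberg's sieve combined with Fejér's kernel: an upper bound for the number of primes in an
interval at which a sequence is close to an integer. -/
theorem card_primes_near_integers_le {A B R H : ℕ} (hAB : A ≤ B) (hR : 1 ≤ R) (hRA : R ≤ A)
    (hH : 1 ≤ H) {x : ℕ → ℝ} {E : ℝ} (hE0 : 0 ≤ E)
    (hE : ∀ r : ℕ, 1 ≤ r → r ≤ R ^ 2 → ∀ j : ℕ, 1 ≤ j → j < H →
      ‖∑ n ∈ (Finset.Ioc A B).filter (fun n => r ∣ n), addExp (j * x n)‖ ≤ E) :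
    (Set.ncard {p : ℕ | p ∈ Finset.Ioc A B ∧ p.Prime ∧ ∃ k : ℤ, |x p - k| * (6 * H) ≤ 1} : ℝ) ≤
      4 / H * (((B : ℝ) - A) * (2 / Real.log (R + 1)) + (R : ℝ) ^ 6) + 4 * (R : ℝ) ^ 6 * E := by
  classical
  obtain ⟨w, hw1, hwb, hV⟩ := exists_selberg_weights R hR
  have hset : {p : ℕ | p ∈ Finset.Ioc A B ∧ p.Prime ∧ ∃ k : ℤ, |x p - k| * (6 * H) ≤ 1} =
      ((Finset.Ioc A B).filter
        (fun p => p.Prime ∧ ∃ k : ℤ, |x p - k| * (6 * H) ≤ 1) : Finset ℕ) := by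
    ext; simp
  rw [hset, Set.ncard_coe_finset]
  set s := (Finset.Ioc A B).filter (fun p => p.Prime ∧ ∃ k : ℤ, |x p - k| * (6 * H) ≤ 1) with hs
  set F : ℕ → ℝ := fun n => ‖∑ j ∈ Finset.range H, addExp (j * x n)‖ ^ 2 with hF
  set W : ℕ → ℝ := fun n => ∑ a ∈ Finset.Icc 1 R, if a ∣ n then w a else 0 with hW
  have hH' : (1 : ℝ) ≤ H := by exact_mod_cast hH
  have hlow : (s.card : ℝ) * ((H : ℝ) ^ 2 / 4) ≤ ∑ n ∈ Finset.Ioc A B, W n ^ 2 * F n := by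
    calc (s.card : ℝ) * ((H : ℝ) ^ 2 / 4) = ∑ n ∈ s, (H : ℝ) ^ 2 / 4 := by simp
      _ ≤ ∑ n ∈ s, W n ^ 2 * F n := by
          refine Finset.sum_le_sum fun p hp => ?_
          obtain ⟨hpI, hpp, k, hk⟩ := Finset.mem_filter.1 hp
          have hW1 : W p = 1 := by
            simp only [hW]
            rw [Finset.sum_eq_single 1]
            · simp [hw1]
            · intro a ha ha1
              rw [if_neg]
              intro had
              rcases (Nat.dvd_prime hpp).1 had with h | h
              · exact ha1 h
              · have := (Finset.mem_Icc.1 ha).2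
                have := (Finset.mem_Ioc.1 hpI).1
                omega
            · intro h; exact absurd (Finset.mem_Icc.2 ⟨le_rfl, hR⟩) h
          rw [hW1, one_pow, one_mul]
          exact sq_div_four_le_norm_sum_addExp_sq hk
      _ ≤ _ := Finset.sum_le_sum_of_subset_of_nonneg (Finset.filter_subset _ _)
          fun _ _ _ => by positivity
  have hexp : ∑ n ∈ Finset.Ioc A B, W n ^ 2 * F n = ∑ a ∈ Finset.Icc 1 R, ∑ b ∈ Finset.Icc 1 R,
      w a * w b * ∑ n ∈ (Finset.Ioc A B).filter (fun n => Nat.lcm a b ∣ n), F n := by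
    have e : ∀ n ∈ Finset.Ioc A B, W n ^ 2 * F n = ∑ a ∈ Finset.Icc 1 R, ∑ b ∈ Finset.Icc 1 R,
        w a * w b * if Nat.lcm a b ∣ n then F n else 0 := by
      intro n _
      simp only [hW]
      rw [sq, Finset.sum_mul_sum, Finset.sum_mul]
      refine Finset.sum_congr rfl fun a _ => ?_
      rw [Finset.sum_mul]
      refine Finset.sum_congr rfl fun b _ => ?_
      by_cases h1 : a ∣ n <;> by_cases h2 : b ∣ n <;> simp [h1, h2, Nat.lcm_dvd_iff]
    rw [Finset.sum_congr rfl e, Finset.sum_comm]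
    refine Finset.sum_congr rfl fun a _ => ?_
    rw [Finset.sum_comm]
    refine Finset.sum_congr rfl fun b _ => ?_
    rw [← Finset.mul_sum, Finset.sum_filter]
  have hQ : ∀ a ∈ Finset.Icc 1 R, ∀ b ∈ Finset.Icc 1 R,
      w a * w b * ∑ n ∈ (Finset.Ioc A B).filter (fun n => Nat.lcm a b ∣ n), F n ≤
        H * ((B : ℝ) - A) * (w a * w b / (Nat.lcm a b : ℝ)) +
          (R : ℝ) ^ 4 * (H + (H : ℝ) ^ 2 * E) := by
    intro a ha b hb
    have ha' := Finset.mem_Icc.1 ha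
    have hb' := Finset.mem_Icc.1 hb
    have hl0 : 0 < Nat.lcm a b := Nat.lcm_pos ha'.1 hb'.1
    have hlR : Nat.lcm a b ≤ R ^ 2 := by
      rw [sq]
      exact (Nat.le_of_dvd (Nat.mul_pos ha'.1 hb'.1) (Nat.lcm_dvd_mul a b)).trans
        (Nat.mul_le_mul ha'.2 hb'.2)
    have h1 := abs_sum_norm_sum_addExp_sq_sub_le hE0 (hE _ hl0 hlR)
    have h2 := abs_card_Ioc_filter_dvd_sub_le hAB hl0
    set Q := ∑ n ∈ (Finset.Ioc A B).filter (fun n => Nat.lcm a b ∣ n), F n with hQdef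
    set m := ((Finset.Ioc A B).filter (fun n => Nat.lcm a b ∣ n)).card
    have h3 : |Q - H * (((B : ℝ) - A) / (Nat.lcm a b : ℝ))| ≤ H + (H : ℝ) ^ 2 * E := by
      have e : Q - H * (((B : ℝ) - A) / (Nat.lcm a b : ℝ)) =
          H * (m - ((B : ℝ) - A) / (Nat.lcm a b : ℝ)) + (Q - H * m) := by ring
      rw [e]
      refine (abs_add_le _ _).trans (add_le_add ?_ h1)
      rw [abs_mul, Nat.abs_cast]
      nlinarith
    have h4 : |w a * w b| ≤ (R : ℝ) ^ 4 := by
      rw [abs_mul]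
      calc |w a| * |w b| ≤ (R : ℝ) ^ 2 * (R : ℝ) ^ 2 :=
            mul_le_mul (hwb a ha) (hwb b hb) (abs_nonneg _) (by positivity)
        _ = _ := by ring
    have h5 : w a * w b * (Q - H * (((B : ℝ) - A) / (Nat.lcm a b : ℝ))) ≤
        (R : ℝ) ^ 4 * (H + (H : ℝ) ^ 2 * E) := by
      refine (le_abs_self _).trans ?_
      rw [abs_mul]
      exact mul_le_mul h4 h3 (abs_nonneg _) (by positivity)
    have e : w a * w b * Q = H * ((B : ℝ) - A) * (w a * w b / (Nat.lcm a b : ℝ)) +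
        w a * w b * (Q - H * (((B : ℝ) - A) / (Nat.lcm a b : ℝ))) := by ring
    rw [e]
    exact add_le_add le_rfl h5
  have hup : ∑ n ∈ Finset.Ioc A B, W n ^ 2 * F n ≤
      H * ((B : ℝ) - A) * (2 / Real.log (R + 1)) + (R : ℝ) ^ 6 * (H + (H : ℝ) ^ 2 * E) := by
    rw [hexp]
    refine (Finset.sum_le_sum fun a ha => Finset.sum_le_sum (hQ a ha)).trans ?_
    simp only [Finset.sum_add_distrib, Finset.sum_const, Nat.card_Icc, Nat.add_sub_cancel,
      nsmul_eq_mul, ← Finset.mul_sum]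
    have hBA : (0 : ℝ) ≤ H * ((B : ℝ) - A) :=
      mul_nonneg (by positivity) (sub_nonneg.2 (by exact_mod_cast hAB))
    refine add_le_add (mul_le_mul_of_nonneg_left hV hBA) (le_of_eq (by ring))
  have hfin := hlow.trans hup
  have hHpos : (0 : ℝ) < H := by linarith
  have e : 4 / H * (((B : ℝ) - A) * (2 / Real.log (R + 1)) + (R : ℝ) ^ 6) + 4 * (R : ℝ) ^ 6 * E =
      (H * ((B : ℝ) - A) * (2 / Real.log (R + 1)) + (R : ℝ) ^ 6 * (H + (H : ℝ) ^ 2 * E)) /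
        ((H : ℝ) ^ 2 / 4) := by
    field_simp
    ring
  rw [e, le_div_iff₀ (by positivity)]
  exact hfin

theorem ConvexOn.second_difference_nonneg {h : ℝ → ℝ} {I : Set ℝ} (hh : ConvexOn ℝ I h) {t s : ℝ}
    (h1 : t ∈ I) (h2 : t + 2 * s ∈ I) : 0 ≤ h (t + 2 * s) - 2 * h (t + s) + h t := by
  have := hh.2 h1 h2 (by norm_num : (0 : ℝ) ≤ 1 / 2) (by norm_num : (0 : ℝ) ≤ 1 / 2) (by norm_num)
  simp only [smul_eq_mul] at this
  rw [show (1 / 2 : ℝ) * t + 1 / 2 * (t + 2 * s) = t + s by ring] at this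
  linarith

/-- Second differences of a function are controlled by bounds on its second derivative. -/
theorem second_difference_mem_Icc {F F' F'' : ℝ → ℝ} {u v A B : ℝ}
    (hF : ∀ x ∈ Set.Icc u v, HasDerivAt F (F' x) x)
    (hF' : ∀ x ∈ Set.Icc u v, HasDerivAt F' (F'' x) x)
    (hA : ∀ x ∈ Set.Icc u v, A ≤ F'' x) (hB : ∀ x ∈ Set.Icc u v, F'' x ≤ B) {t s : ℝ}
    (h1 : t ∈ Set.Icc u v) (h2 : t + 2 * s ∈ Set.Icc u v) :
    A * s ^ 2 ≤ F (t + 2 * s) - 2 * F (t + s) + F t ∧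
      F (t + 2 * s) - 2 * F (t + s) + F t ≤ B * s ^ 2 := by
  have hq : ∀ k x : ℝ, HasDerivAt (fun y => k / 2 * y ^ 2) (k * x) x := fun k x => by
    refine ((hasDerivAt_pow 2 x).const_mul (k / 2)).congr_deriv ?_
    push_cast; ring
  have hq' : ∀ k x : ℝ, HasDerivAt (fun y => k * y) k x := fun k x => by
    simpa using (hasDerivAt_id x).const_mul k
  have c1 : ConvexOn ℝ (Set.Icc u v) (fun y => F y - A / 2 * y ^ 2) :=
    convexOn_of_hasDerivWithinAt2_nonneg (convex_Icc u v)
      (f' := fun y => F' y - A * y) (f'' := fun y => F'' y - A)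
      (fun x hx => ((hF x hx).sub (hq A x)).continuousAt.continuousWithinAt)
      (fun x hx => ((hF x (interior_subset hx)).sub (hq A x)).hasDerivWithinAt)
      (fun x hx => ((hF' x (interior_subset hx)).sub (hq' A x)).hasDerivWithinAt)
      (fun x hx => sub_nonneg.2 (hA x (interior_subset hx)))
  have c2 : ConvexOn ℝ (Set.Icc u v) (fun y => B / 2 * y ^ 2 - F y) :=
    convexOn_of_hasDerivWithinAt2_nonneg (convex_Icc u v)
      (f' := fun y => B * y - F' y) (f'' := fun y => B - F'' y)
      (fun x hx => ((hq B x).sub (hF x hx)).continuousAt.continuousWithinAt)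
      (fun x hx => ((hq B x).sub (hF x (interior_subset hx))).hasDerivWithinAt)
      (fun x hx => ((hq' B x).sub (hF' x (interior_subset hx))).hasDerivWithinAt)
      (fun x hx => sub_nonneg.2 (hB x (interior_subset hx)))
  have d1 := c1.second_difference_nonneg h1 h2
  have d2 := c2.second_difference_nonneg h1 h2
  constructor <;> nlinarith

/-- The function `t ↦ (1 - t^c)^(1/c)` is uniformly concave on compact subsets of `(0, 1)`. -/
theorem exists_second_difference_bounds {c u v : ℝ} (hc : 1 < c) (hu : 0 < u) (hv : v < 1)
    (huv : u ≤ v) :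
    ∃ A B : ℝ, 0 < A ∧ A ≤ B ∧ ∀ t s : ℝ, u ≤ t → 0 ≤ s → t + 2 * s ≤ v →
      A * s ^ 2 ≤ -((1 - (t + 2 * s) ^ c) ^ (1 / c) - 2 * (1 - (t + s) ^ c) ^ (1 / c)
        + (1 - t ^ c) ^ (1 / c)) ∧
      -((1 - (t + 2 * s) ^ c) ^ (1 / c) - 2 * (1 - (t + s) ^ c) ^ (1 / c)
        + (1 - t ^ c) ^ (1 / c)) ≤ B * s ^ 2 := by
  have hc0 : 0 < c := by linarith
  set Φ : ℝ → ℝ := fun t => (c - 1) * t ^ (c - 2) * (1 - t ^ c) ^ (1 / c - 2) with hΦ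
  have hpos : ∀ t ∈ Set.Icc u v, 0 < t ∧ 0 < 1 - t ^ c := fun t ht => by
    have h0 : 0 < t := hu.trans_le ht.1
    exact ⟨h0, sub_pos.2 (Real.rpow_lt_one h0.le (ht.2.trans_lt hv) hc0)⟩
  have hcont : ContinuousOn Φ (Set.Icc u v) := by
    intro t ht
    obtain ⟨h0, h1⟩ := hpos t ht
    refine ContinuousAt.continuousWithinAt ?_
    have e1 : ContinuousAt (fun t : ℝ => t ^ (c - 2)) t :=
      Real.continuousAt_rpow_const _ _ (Or.inl h0.ne')
    have e2 : ContinuousAt (fun t : ℝ => 1 - t ^ c) t :=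
      continuousAt_const.sub (Real.continuousAt_rpow_const _ _ (Or.inl h0.ne'))
    exact (continuousAt_const.mul e1).mul (e2.rpow_const (Or.inl h1.ne'))
  obtain ⟨a, ha, hamin⟩ := isCompact_Icc.exists_isMinOn (Set.nonempty_Icc.2 huv) hcont
  obtain ⟨b, hb, hbmax⟩ := isCompact_Icc.exists_isMaxOn (Set.nonempty_Icc.2 huv) hcont
  have hd1 : ∀ x ∈ Set.Icc u v, HasDerivAt (fun t : ℝ => -(1 - t ^ c) ^ (1 / c))
      (x ^ (c - 1) * (1 - x ^ c) ^ (1 / c - 1)) x := by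
    intro x hx
    obtain ⟨h0, h1⟩ := hpos x hx
    have e1 := (Real.hasDerivAt_rpow_const (p := c) (Or.inl h0.ne')).const_sub 1
    have e2 := (e1.rpow_const (p := 1 / c) (Or.inl h1.ne')).neg
    refine HasDerivAt.congr_deriv e2 ?_
    field_simp
  have hd2 : ∀ x ∈ Set.Icc u v,
      HasDerivAt (fun x : ℝ => x ^ (c - 1) * (1 - x ^ c) ^ (1 / c - 1)) (Φ x) x := by
    intro x hx
    obtain ⟨h0, h1⟩ := hpos x hx
    have e1 := (Real.hasDerivAt_rpow_const (p := c) (Or.inl h0.ne')).const_sub 1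
    have e2 := e1.rpow_const (p := 1 / c - 1) (Or.inl h1.ne')
    have e3 := (Real.hasDerivAt_rpow_const (p := c - 1) (Or.inl h0.ne')).mul e2
    refine HasDerivAt.congr_deriv e3 ?_
    symm
    have f1 : (1 - x ^ c) ^ (1 / c - 1) = (1 - x ^ c) ^ (1 / c - 2) * (1 - x ^ c) := by
      rw [← Real.rpow_add_one h1.ne']; congr 1; ring
    have f2 : (1 / c - 1 - 1 : ℝ) = 1 / c - 2 := by ring
    have f3 : (c - 1 - 1 : ℝ) = c - 2 := by ring
    have f4 : x ^ (c - 1) = x ^ (c - 2) * x := by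
      rw [← Real.rpow_add_one h0.ne']; congr 1; ring
    have f5 : x ^ c = x ^ (c - 2) * x * x := by
      rw [← f4, ← Real.rpow_add_one h0.ne']; congr 1; ring
    simp only [hΦ]
    rw [f1, f2, f3]
    generalize (1 - x ^ c) ^ (1 / c - 2) = Z
    rw [f4, f5]
    field_simp
    ring
  refine ⟨Φ a, Φ b, ?_, hamin hb, ?_⟩
  · obtain ⟨h0, h1⟩ := hpos a ha
    have : 0 < c - 1 := by linarith
    positivity
  · intro t s ht hs hts
    have := second_difference_mem_Icc hd1 hd2 (fun x hx => hamin hx) (fun x hx => hbmax hx)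
      (t := t) (s := s) ⟨ht, by linarith⟩ ⟨by linarith, hts⟩
    refine ⟨this.1.trans (le_of_eq ?_), (le_of_eq ?_).trans this.2⟩ <;> ring

theorem sub_rpow_rpow_eq_scaled {c : ℝ} (hc : 0 < c) {N : ℕ} (hN : 1 ≤ N) {x : ℝ} (hx : 0 ≤ x)
    (hxN : x ≤ (N : ℝ) ^ (1 / c)) :
    ((N : ℝ) - x ^ c) ^ (1 / c) =
      (N : ℝ) ^ (1 / c) * (1 - (x / (N : ℝ) ^ (1 / c)) ^ c) ^ (1 / c) := by
  have hN0 : (0 : ℝ) < N := by exact_mod_cast hN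
  have hX : (0 : ℝ) < (N : ℝ) ^ (1 / c) := Real.rpow_pos_of_pos hN0 _
  have h1 : ((N : ℝ) ^ (1 / c)) ^ c = N := by
    rw [← Real.rpow_mul hN0.le, one_div_mul_cancel hc.ne', Real.rpow_one]
  rw [Real.div_rpow hx hX.le, h1]
  have h2 : x ^ c / N ≤ 1 := by
    rw [div_le_one hN0, ← h1]
    exact Real.rpow_le_rpow hx hxN hc.le
  rw [← Real.mul_rpow hN0.le (by linarith)]
  congr 1
  field_simp

/-- Exponential sums over multiples of `r` in `(P, 2P]`. -/
theorem norm_sum_addExp_rpow_le {c A B : ℝ} (hc : 1 < c) (hA : 0 < A) (hAB : A ≤ B)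
    (h : ∀ t s : ℝ, ((10 : ℝ) ^ 9)⁻¹ ≤ t → 0 ≤ s → t + 2 * s ≤ 3 * ((10 : ℝ) ^ 9)⁻¹ →
      A * s ^ 2 ≤ -((1 - (t + 2 * s) ^ c) ^ (1 / c) - 2 * (1 - (t + s) ^ c) ^ (1 / c)
        + (1 - t ^ c) ^ (1 / c)) ∧
      -((1 - (t + 2 * s) ^ c) ^ (1 / c) - 2 * (1 - (t + s) ^ c) ^ (1 / c)
        + (1 - t ^ c) ^ (1 / c)) ≤ B * s ^ 2)
    {N r : ℕ} (hN : 1 ≤ N) (hr : 1 ≤ r) (hrP : (r : ℝ) ≤ PP c N) {θ Δ : ℝ} (hθ : 0 < θ)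
    (hΔ : 0 < Δ) :
    ‖∑ n ∈ (Finset.Ioc ⌊PP c N⌋₊ ⌊2 * PP c N⌋₊).filter (fun n => r ∣ n),
      addExp (θ * ((N : ℝ) - (n : ℝ) ^ c) ^ (1 / c))‖ ≤
      (N : ℝ) ^ (1 / c) * Δ +
        (θ * r ^ 2 * B + 3) * (2 * Δ * (N : ℝ) ^ (1 / c) / (θ * r ^ 2 * A) + 1) +
        (4 + 7 * (θ * r ^ 2 * B)) / Δ ^ 3 := by
  have hc0 : 0 < c := by linarith
  have hN0 : (0 : ℝ) < N := by exact_mod_cast hN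
  have hr0 : (0 : ℝ) < r := by exact_mod_cast hr
  have hB : 0 < B := hA.trans_le hAB
  set X := (N : ℝ) ^ (1 / c) with hXdef
  have hX : 0 < X := Real.rpow_pos_of_pos hN0 _
  have hP : PP c N = ((10 : ℝ) ^ 9)⁻¹ * X := rfl
  have hPpos : 0 < PP c N := by rw [hP]; positivity
  rw [sum_Ioc_filter_dvd hr]
  set a := ⌊PP c N⌋₊ / r with ha
  set K := ⌊2 * PP c N⌋₊ / r - a with hK
  set f : ℕ → ℝ := fun i => -(θ * ((N : ℝ) - ((r * (a + 1 + i) : ℕ) : ℝ) ^ c) ^ (1 / c)) with hf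
  have hconj : ‖∑ i ∈ Finset.range K,
      addExp (θ * ((N : ℝ) - ((r * (a + 1 + i) : ℕ) : ℝ) ^ c) ^ (1 / c))‖ =
      ‖∑ i ∈ Finset.range K, addExp (f i)‖ := by
    rw [← RCLike.norm_conj, map_sum]
    congr 1
    exact Finset.sum_congr rfl fun i _ => (addExp_neg _).symm
  rw [hconj]
  have hlow : PP c N ≤ r * (a + 1 : ℝ) := by
    have h1 := Nat.lt_floor_add_one (PP c N)
    have h2 : ⌊PP c N⌋₊ + 1 ≤ r * (a + 1) :=
      (Nat.lt_mul_of_div_lt (Nat.lt_succ_self _) hr).trans_eq (mul_comm _ _)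
    have h3 : (⌊PP c N⌋₊ : ℝ) + 1 ≤ r * (a + 1 : ℝ) := by exact_mod_cast h2
    linarith
  have hhigh : ∀ i : ℕ, i + 1 < K → (r : ℝ) * (a + 1 + i + 2) ≤ 3 * PP c N := by
    intro i hi
    have h1 : a + 1 + i + 2 ≤ ⌊2 * PP c N⌋₊ / r + 1 := by omega
    have h2 : r * (⌊2 * PP c N⌋₊ / r) ≤ ⌊2 * PP c N⌋₊ := Nat.mul_div_le _ _
    have h3 : r * (a + 1 + i + 2) ≤ ⌊2 * PP c N⌋₊ + r := by
      calc r * (a + 1 + i + 2) ≤ r * (⌊2 * PP c N⌋₊ / r + 1) := Nat.mul_le_mul_left _ h1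
        _ = r * (⌊2 * PP c N⌋₊ / r) + r := by ring
        _ ≤ _ := by omega
    have h4 : (r : ℝ) * (a + 1 + i + 2) ≤ ⌊2 * PP c N⌋₊ + r := by exact_mod_cast h3
    have h5 := Nat.floor_le (by positivity : 0 ≤ 2 * PP c N)
    linarith
  have hKX : (K : ℝ) ≤ X := by
    have h1 : K ≤ ⌊2 * PP c N⌋₊ := (Nat.sub_le _ _).trans (Nat.div_le_self _ _)
    have h2 := Nat.floor_le (by positivity : 0 ≤ 2 * PP c N)
    have h3 : (K : ℝ) ≤ ⌊2 * PP c N⌋₊ := by exact_mod_cast h1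
    rw [hP] at h2 h3
    have : 2 * (((10 : ℝ) ^ 9)⁻¹ * X) ≤ X := by norm_num; linarith
    linarith
  have hsd : ∀ i : ℕ, i + 1 < K → θ * r ^ 2 * A / X ≤ f (i + 2) - 2 * f (i + 1) + f i ∧
      f (i + 2) - 2 * f (i + 1) + f i ≤ θ * r ^ 2 * B / X := by
    intro i hi
    have hh := hhigh i hi
    have hi0 : (0 : ℝ) ≤ i := Nat.cast_nonneg i
    set t : ℝ := r * (a + 1 + i) / X with ht
    set s : ℝ := r / X with hs
    have e0 : ∀ k : ℕ, k ≤ 2 →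
        f (i + k) = -(θ * (X * (1 - (t + k * s) ^ c) ^ (1 / c))) := by
      intro k hk
      have hk' : (k : ℝ) ≤ 2 := by exact_mod_cast hk
      simp only [hf]
      rw [sub_rpow_rpow_eq_scaled hc0 hN (Nat.cast_nonneg _), ← hXdef]
      · have : (((r * (a + 1 + (i + k)) : ℕ) : ℝ)) / X = t + k * s := by
          rw [ht, hs]; push_cast; ring
        rw [this]
      · push_cast
        have e1 : (r : ℝ) * (a + 1 + (i + k)) ≤ r * (a + 1 + i + 2) :=
          mul_le_mul_of_nonneg_left (by linarith) hr0.le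
        rw [← hXdef]
        rw [hP] at hh
        have : 3 * (((10 : ℝ) ^ 9)⁻¹ * X) ≤ X := by norm_num; linarith
        linarith
    have h1 : ((10 : ℝ) ^ 9)⁻¹ ≤ t := by
      rw [ht, le_div_iff₀ hX, ← hP]
      nlinarith
    have h2 : t + 2 * s ≤ 3 * ((10 : ℝ) ^ 9)⁻¹ := by
      have : t + 2 * s = r * (a + 1 + i + 2) / X := by rw [ht, hs]; ring
      rw [this, div_le_iff₀ hX, mul_assoc, ← hP]
      exact hh
    obtain ⟨g1, g2⟩ := h t s h1 (by positivity) h2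
    have e00 := e0 0 (by norm_num)
    have e01 := e0 1 (by norm_num)
    have e02 := e0 2 (by norm_num)
    simp only [Nat.cast_zero, zero_mul, add_zero, Nat.cast_one, one_mul, Nat.cast_ofNat]
      at e00 e01 e02
    have e3 : f (i + 2) - 2 * f (i + 1) + f i = θ * X * (-((1 - (t + 2 * s) ^ c) ^ (1 / c)
        - 2 * (1 - (t + s) ^ c) ^ (1 / c) + (1 - t ^ c) ^ (1 / c))) := by
      rw [e00, e01, e02]; ring
    have e4 : ∀ D : ℝ, θ * r ^ 2 * D / X = θ * X * (D * s ^ 2) := by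
      intro D; rw [hs]; field_simp
    rw [e3, e4, e4]
    exact ⟨mul_le_mul_of_nonneg_left g1 (by positivity),
      mul_le_mul_of_nonneg_left g2 (by positivity)⟩
  refine (norm_sum_addExp_le (by positivity : 0 < θ * r ^ 2 * A / X)
    (by positivity : 0 ≤ θ * r ^ 2 * B / X) hΔ (fun i hi => (hsd i hi).1)
    (fun i hi => (hsd i hi).2)).trans ?_
  have hKμ : (K : ℝ) * (θ * r ^ 2 * B / X) ≤ θ * r ^ 2 * B := by
    calc (K : ℝ) * (θ * r ^ 2 * B / X) ≤ X * (θ * r ^ 2 * B / X) := by gcongr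
      _ = _ := by field_simp
  have e5 : 2 * Δ / (θ * r ^ 2 * A / X) = 2 * Δ * X / (θ * r ^ 2 * A) := by field_simp
  rw [e5]
  gcongr

/-- A solution of `[n^c] + [m^c] = N` forces `m` into a short interval. -/
theorem mem_Ico_of_floor_add_floor_eq {c : ℝ} (hc : 1 < c) {N n m : ℕ} (hN : 1 ≤ N)
    (hn : (n : ℝ) ≤ 2 * PP c N)
    (h : ⌊(n : ℝ) ^ c⌋ + ⌊(m : ℝ) ^ c⌋ = (N : ℤ)) :
    ((N : ℝ) - (n : ℝ) ^ c) ^ (1 / c) ≤ m ∧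
      (m : ℝ) < ((N : ℝ) - (n : ℝ) ^ c) ^ (1 / c) + 4 * (N : ℝ) ^ (1 / c - 1) := by
  have hc0 : 0 < c := by linarith
  have hN0 : (0 : ℝ) < N := by exact_mod_cast hN
  have hγ1 : 1 / c ≤ 1 := by rw [div_le_one hc0]; exact hc.le
  have hγ0 : 0 < 1 / c := by positivity
  have hX : (0 : ℝ) < (N : ℝ) ^ (1 / c) := Real.rpow_pos_of_pos hN0 _
  have hnc : (n : ℝ) ^ c ≤ N / 2 := by
    have h1 : ((N : ℝ) ^ (1 / c)) ^ c = N := by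
      rw [← Real.rpow_mul hN0.le, one_div_mul_cancel hc0.ne', Real.rpow_one]
    have h2 : (n : ℝ) ≤ 1 / 2 * (N : ℝ) ^ (1 / c) := by
      refine hn.trans ?_
      rw [PP]
      linarith
    calc (n : ℝ) ^ c ≤ (1 / 2 * (N : ℝ) ^ (1 / c)) ^ c :=
          Real.rpow_le_rpow (by positivity) h2 hc0.le
      _ = (1 / 2 : ℝ) ^ c * N := by rw [Real.mul_rpow (by norm_num) hX.le, h1]
      _ ≤ (1 / 2 : ℝ) ^ (1 : ℝ) * N := by
          exact mul_le_mul_of_nonneg_right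
            (Real.rpow_le_rpow_of_exponent_ge (by norm_num) (by norm_num) hc.le) hN0.le
      _ = N / 2 := by rw [Real.rpow_one]; ring
  set Y := (N : ℝ) - (n : ℝ) ^ c with hY
  have hYN : N / 2 ≤ Y := by linarith
  have hY0 : 0 < Y := by linarith
  have h' : ((⌊(n : ℝ) ^ c⌋ : ℤ) : ℝ) + ((⌊(m : ℝ) ^ c⌋ : ℤ) : ℝ) = N := by exact_mod_cast h
  have f1 := Int.floor_le ((n : ℝ) ^ c)
  have f2 := Int.lt_floor_add_one ((n : ℝ) ^ c)
  have f3 := Int.floor_le ((m : ℝ) ^ c)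
  have f4 := Int.lt_floor_add_one ((m : ℝ) ^ c)
  have hm : ((m : ℝ) ^ c) ^ (1 / c) = m := by
    rw [← Real.rpow_mul (Nat.cast_nonneg m), mul_one_div_cancel hc0.ne', Real.rpow_one]
  constructor
  · rw [← hm]
    exact Real.rpow_le_rpow hY0.le (by linarith) hγ0.le
  · have g1 : (m : ℝ) < (Y + 2) ^ (1 / c) := by
      rw [← hm]
      exact Real.rpow_lt_rpow (by positivity) (by linarith) hγ0
    have g2 : (Y + 2) ^ (1 / c) ≤ Y ^ (1 / c) + 2 * Y ^ (1 / c - 1) := by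
      have e1 : Y + 2 = Y * (1 + 2 / Y) := by field_simp
      have e2 := rpow_one_add_le_one_add_mul_self (s := 2 / Y)
        (by have : 0 < 2 / Y := by positivity
            linarith) hγ0.le hγ1
      have e3 : 1 + 1 / c * (2 / Y) ≤ 1 + 2 / Y := by
        have : 1 / c * (2 / Y) ≤ 1 * (2 / Y) := by gcongr
        linarith
      rw [e1, Real.mul_rpow hY0.le (by positivity), Real.rpow_sub_one hY0.ne']
      calc Y ^ (1 / c) * (1 + 2 / Y) ^ (1 / c) ≤ Y ^ (1 / c) * (1 + 2 / Y) :=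
            mul_le_mul_of_nonneg_left (e2.trans e3) (by positivity)
        _ = _ := by ring
    have g3 : Y ^ (1 / c - 1) ≤ 2 * (N : ℝ) ^ (1 / c - 1) := by
      calc Y ^ (1 / c - 1) ≤ (N / 2) ^ (1 / c - 1) :=
            Real.rpow_le_rpow_of_nonpos (by positivity) hYN (by linarith)
        _ = (2 : ℝ) ^ (1 - 1 / c) * (N : ℝ) ^ (1 / c - 1) := by
            rw [Real.div_rpow hN0.le (by norm_num), div_eq_mul_inv, ← Real.rpow_neg (by norm_num),
              neg_sub, mul_comm]
        _ ≤ (2 : ℝ) ^ (1 : ℝ) * (N : ℝ) ^ (1 / c - 1) := by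
            gcongr
            · norm_num
            · linarith
        _ = _ := by rw [Real.rpow_one]
    linarith

theorem floor_rpow_strictMono {c : ℝ} (hc : 1 ≤ c) : StrictMono fun n : ℕ => ⌊(n : ℝ) ^ c⌋ := by
  refine strictMono_nat_of_lt_succ fun n => ?_
  have h := Real.add_rpow_le_rpow_add (Nat.cast_nonneg n : (0 : ℝ) ≤ n) zero_le_one hc
  rw [Real.one_rpow] at h
  have h1 := Int.floor_le_floor h
  rw [Int.floor_add_one] at h1
  push_cast
  exact Int.lt_of_add_one_le h1

/-- Trivial bound for the number of solutions with `d² ∣ m`. -/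
theorem sum_cnt_le {c : ℝ} (hc : 1 < c) {N d : ℕ} (hN : 1 ≤ N) (hd : 1 ≤ d) :
    ∑ p ∈ primesIn c N, (cnt c N d p : ℝ) ≤ 2 * (N : ℝ) ^ (1 / c) / d ^ 2 := by
  classical
  have hc0 : 0 < c := by linarith
  have hN0 : (0 : ℝ) < N := by exact_mod_cast hN
  set X := (N : ℝ) ^ (1 / c) with hXdef
  have hX : 0 < X := Real.rpow_pos_of_pos hN0 _
  set S : ℕ → Finset ℕ := fun p => (Finset.Ioc 0 ⌊2 * X⌋₊).filter
    (fun m => d ^ 2 ∣ m ∧ ⌊(p : ℝ) ^ c⌋ + ⌊(m : ℝ) ^ c⌋ = (N : ℤ)) with hS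
  have hcnt : ∀ p, cnt c N d p = (S p).card := by
    intro p
    rw [cnt, ← Set.ncard_coe_finset]
    congr 1
    ext m
    simp only [Set.mem_ofPred_eq, hS, Finset.coe_filter, Finset.mem_Ioc]
    constructor
    · rintro ⟨h1, h2, h3⟩
      refine ⟨⟨h1, Nat.le_floor ?_⟩, h2, h3⟩
      have h4 : (0 : ℤ) ≤ ⌊(p : ℝ) ^ c⌋ := Int.floor_nonneg.2 (by positivity)
      have h5 : ⌊(m : ℝ) ^ c⌋ ≤ (N : ℤ) := by omega
      have h6 := Int.lt_floor_add_one ((m : ℝ) ^ c)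
      have h7 : ((⌊(m : ℝ) ^ c⌋ : ℤ) : ℝ) ≤ N := by exact_mod_cast h5
      have hN1 : (1 : ℝ) ≤ N := by exact_mod_cast hN
      have hm : ((m : ℝ) ^ c) ^ (1 / c) = m := by
        rw [← Real.rpow_mul (Nat.cast_nonneg m), mul_one_div_cancel hc0.ne', Real.rpow_one]
      calc (m : ℝ) = ((m : ℝ) ^ c) ^ (1 / c) := hm.symm
        _ ≤ (2 * N) ^ (1 / c) := Real.rpow_le_rpow (by positivity) (by linarith) (by positivity)
        _ = 2 ^ (1 / c) * X := Real.mul_rpow (by norm_num) hN0.le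
        _ ≤ 2 ^ (1 : ℝ) * X := by
            gcongr
            · norm_num
            · rw [div_le_one hc0]; exact hc.le
        _ = 2 * X := by rw [Real.rpow_one]
    · rintro ⟨⟨h1, _⟩, h2, h3⟩
      exact ⟨h1, h2, h3⟩
  have hdisj : (primesIn c N : Set ℕ).PairwiseDisjoint S := by
    intro p _ q _ hpq
    refine Finset.disjoint_left.2 fun m hm hm' => hpq ?_
    have h1 := (Finset.mem_filter.1 hm).2.2
    have h2 := (Finset.mem_filter.1 hm').2.2
    exact (floor_rpow_strictMono hc.le).injective (by omega)
  have hsub : (primesIn c N).biUnion S ⊆ (Finset.Ioc 0 ⌊2 * X⌋₊).filter (fun m => d ^ 2 ∣ m) := by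
    intro m hm
    obtain ⟨p, _, hp⟩ := Finset.mem_biUnion.1 hm
    have := Finset.mem_filter.1 hp
    exact Finset.mem_filter.2 ⟨this.1, this.2.1⟩
  have h1 := Finset.card_le_card hsub
  rw [Finset.card_biUnion hdisj, Nat.Ioc_filter_dvd_card_eq_div] at h1
  have h2 : ∑ p ∈ primesIn c N, (cnt c N d p : ℝ) ≤ ((⌊2 * X⌋₊ / d ^ 2 : ℕ) : ℝ) := by
    rw [Finset.sum_congr rfl fun p _ => by rw [hcnt p]]
    exact_mod_cast h1
  refine h2.trans (Nat.cast_div_le.trans ?_)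
  push_cast
  gcongr
  exact Nat.floor_le (by positivity)

theorem sum_ite_inv_sq_le {t : ℝ} (ht : 0 < t) (n : ℕ) :
    ∑ d ∈ Finset.range n, (if t < (d : ℝ) then 1 / (d : ℝ) ^ 2 else 0) ≤ 2 / t := by
  have h := sum_Ioo_inv_sq_le (α := ℝ) ⌊t⌋₊ n
  have h2 : (2 : ℝ) / (⌊t⌋₊ + 1) ≤ 2 / t := by
    gcongr
    exact (Nat.lt_floor_add_one t).le
  refine le_trans ?_ (h.trans h2)
  rw [← Finset.sum_filter]
  refine (Finset.sum_le_sum_of_subset_of_nonneg ?_ fun _ _ _ => by positivity).trans_eq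
    (Finset.sum_congr rfl fun d _ => one_div _)
  intro d hd
  simp only [Finset.mem_filter, Finset.mem_range] at hd
  exact Finset.mem_Ioo.2 ⟨(Nat.floor_lt ht.le).2 hd.2, hd.1⟩

theorem summable_ite_inv_sq {t : ℝ} (ht : 0 < t) :
    Summable fun d : ℕ => if t < (d : ℝ) then 1 / (d : ℝ) ^ 2 else 0 :=
  summable_of_sum_range_le (fun d => by split_ifs <;> positivity) (sum_ite_inv_sq_le ht)

theorem tsum_ite_inv_sq_le {t : ℝ} (ht : 0 < t) :
    ∑' d : ℕ, (if t < (d : ℝ) then 1 / (d : ℝ) ^ 2 else 0) ≤ 2 / t :=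
  Real.tsum_le_of_sum_range_le (fun d => by split_ifs <;> positivity) (sum_ite_inv_sq_le ht)

theorem norm_sum_addExp_rpow_le_of_scale {c A B : ℝ} (hc : 1 < c) (hA : 0 < A) (hAB : A ≤ B)
    (h : ∀ t s : ℝ, ((10 : ℝ) ^ 9)⁻¹ ≤ t → 0 ≤ s → t + 2 * s ≤ 3 * ((10 : ℝ) ^ 9)⁻¹ →
      A * s ^ 2 ≤ -((1 - (t + 2 * s) ^ c) ^ (1 / c) - 2 * (1 - (t + s) ^ c) ^ (1 / c)
        + (1 - t ^ c) ^ (1 / c)) ∧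
      -((1 - (t + 2 * s) ^ c) ^ (1 / c) - 2 * (1 - (t + s) ^ c) ^ (1 / c)
        + (1 - t ^ c) ^ (1 / c)) ≤ B * s ^ 2)
    {N r : ℕ} (hN : 1 ≤ N) (hr : 1 ≤ r) (hrP : (r : ℝ) ≤ PP c N) {θ ν : ℝ} (hν : 1 ≤ ν)
    (hX : ν ^ 963 ≤ (N : ℝ) ^ (1 / c)) (hθ : 1 ≤ θ * r ^ 2 * ν ^ 80) (hθ' : θ * r ^ 2 ≤ ν ^ 41) :
    ‖∑ n ∈ (Finset.Ioc ⌊PP c N⌋₊ ⌊2 * PP c N⌋₊).filter (fun n => r ∣ n),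
      addExp (θ * ((N : ℝ) - (n : ℝ) ^ c) ^ (1 / c))‖ ≤
      (8 + 8 * B + (2 * B + 6) / A) * ((N : ℝ) ^ (1 / c) / ν ^ 140) := by
  have hν0 : 0 < ν := by linarith
  have hr0 : (0 : ℝ) < r := by exact_mod_cast hr
  have hB : 0 < B := hA.trans_le hAB
  have hθ0 : 0 < θ := by
    by_contra hneg
    have : θ * r ^ 2 * ν ^ 80 ≤ 0 :=
      mul_nonpos_of_nonpos_of_nonneg
        (mul_nonpos_of_nonpos_of_nonneg (not_lt.1 hneg) (by positivity)) (by positivity)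
    linarith
  refine (norm_sum_addExp_rpow_le hc hA hAB h hN hr hrP hθ0
    (by positivity : 0 < (ν ^ 220)⁻¹)).trans ?_
  set X := (N : ℝ) ^ (1 / c)
  set T := θ * (r : ℝ) ^ 2
  have hT : 0 < T := by positivity
  have hX0 : 0 < X := lt_of_lt_of_le (by positivity) hX
  have p1 : X * (ν ^ 220)⁻¹ ≤ X / ν ^ 140 := by
    rw [← div_eq_mul_inv]
    gcongr
    norm_num
  have p2 : X * (ν ^ 220)⁻¹ / T ≤ X / ν ^ 140 := by
    rw [div_le_iff₀ hT]
    calc X * (ν ^ 220)⁻¹ = X / ν ^ 220 * 1 := by rw [mul_one, div_eq_mul_inv]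
      _ ≤ X / ν ^ 220 * (T * ν ^ 80) := by gcongr
      _ = X / ν ^ 140 * T := by field_simp
  have p3 : ν ^ 701 ≤ X / ν ^ 140 := by
    rw [le_div_iff₀ (by positivity), ← pow_add]
    exact (pow_le_pow_right₀ hν (by norm_num)).trans hX
  have p4 : ν ^ 41 ≤ ν ^ 701 := pow_le_pow_right₀ hν (by norm_num)
  have p5 : ν ^ 660 ≤ ν ^ 701 := pow_le_pow_right₀ hν (by norm_num)
  have p6 : 1 ≤ ν ^ 701 := one_le_pow₀ hν
  have p7 : T * ν ^ 660 ≤ ν ^ 701 := by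
    calc T * ν ^ 660 ≤ ν ^ 41 * ν ^ 660 := by gcongr
      _ = ν ^ 701 := by rw [← pow_add]
  have e1 : X * (ν ^ 220)⁻¹ + (T * B + 3) * (2 * (ν ^ 220)⁻¹ * X / (T * A) + 1) +
      (4 + 7 * (T * B)) / ((ν ^ 220)⁻¹) ^ 3 =
      X * (ν ^ 220)⁻¹ * (1 + 2 * B / A) + X * (ν ^ 220)⁻¹ / T * (6 / A) + (T * B + 3) +
      (4 * ν ^ 660 + 7 * B * (T * ν ^ 660)) := by
    have : ((ν ^ 220)⁻¹ : ℝ) ^ 3 = (ν ^ 660)⁻¹ := by rw [inv_pow, ← pow_mul]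
    rw [this, div_inv_eq_mul]
    field_simp
    ring
  rw [e1]
  set Z := X / ν ^ 140
  have q1 : X * (ν ^ 220)⁻¹ * (1 + 2 * B / A) ≤ Z * (1 + 2 * B / A) := by gcongr
  have q2 : X * (ν ^ 220)⁻¹ / T * (6 / A) ≤ Z * (6 / A) := by gcongr
  have q3 : T * B ≤ B * Z := by
    rw [mul_comm]; exact mul_le_mul_of_nonneg_left (by linarith) hB.le
  have q4 : 7 * B * (T * ν ^ 660) ≤ 7 * B * Z :=
    mul_le_mul_of_nonneg_left (by linarith) (by positivity)
  have e2 : (8 + 8 * B + (2 * B + 6) / A) * Z =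
      Z * (1 + 2 * B / A) + Z * (6 / A) + 7 * Z + B * Z + 7 * B * Z := by
    field_simp; ring
  rw [e2]
  linarith

theorem sum_log_mul_cnt_le {c A B : ℝ} (hc : 1 < c) (hA : 0 < A) (hAB : A ≤ B)
    (h : ∀ t s : ℝ, ((10 : ℝ) ^ 9)⁻¹ ≤ t → 0 ≤ s → t + 2 * s ≤ 3 * ((10 : ℝ) ^ 9)⁻¹ →
      A * s ^ 2 ≤ -((1 - (t + 2 * s) ^ c) ^ (1 / c) - 2 * (1 - (t + s) ^ c) ^ (1 / c)
        + (1 - t ^ c) ^ (1 / c)) ∧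
      -((1 - (t + 2 * s) ^ c) ^ (1 / c) - 2 * (1 - (t + s) ^ c) ^ (1 / c)
        + (1 - t ^ c) ^ (1 / c)) ≤ B * s ^ 2)
    {N d : ℕ} (hN : 1 ≤ N) (hd : 1 ≤ d) {ν : ℝ} (hν : 10 ^ 10 ≤ ν) (hνN : ν ^ 1000 = N)
    (hL : Real.log N ≤ ν) (hX : ν ^ 963 ≤ (N : ℝ) ^ (1 / c)) (hY : 48 ≤ (N : ℝ) ^ (1 - 1 / c))
    (hdν : (d : ℝ) ≤ ν ^ 40) :
    ∑ p ∈ primesIn c N, Real.log p * (cnt c N d p : ℝ) ≤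
      (384192 + 4 * (8 + 8 * B + (2 * B + 6) / A)) * (N : ℝ) ^ (2 * (1 / c) - 1) / d ^ 2 := by
  classical
  have hN0 : (0 : ℝ) < N := by exact_mod_cast hN
  have hν1 : (1 : ℝ) ≤ ν := by linarith
  have hν0 : (0 : ℝ) < ν := by linarith
  have hd0 : (0 : ℝ) < d := by exact_mod_cast hd
  have hd1 : (1 : ℝ) ≤ d := by exact_mod_cast hd
  have hB : 0 < B := hA.trans_le hAB
  have hXY : (N : ℝ) ^ (1 / c) * (N : ℝ) ^ (1 - 1 / c) = N := by
    rw [← Real.rpow_add hN0, add_sub_cancel, Real.rpow_one]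
  have hXdY : (N : ℝ) ^ (2 * (1 / c) - 1) = (N : ℝ) ^ (1 / c) / (N : ℝ) ^ (1 - 1 / c) := by
    rw [← Real.rpow_sub hN0]; congr 1; ring
  have hYinv : (N : ℝ) ^ (1 / c - 1) = ((N : ℝ) ^ (1 - 1 / c))⁻¹ := by
    rw [← Real.rpow_neg hN0.le, neg_sub]
  set X := (N : ℝ) ^ (1 / c) with hXdef
  set Y := (N : ℝ) ^ (1 - 1 / c) with hYdef
  have hX0 : 0 < X := Real.rpow_pos_of_pos hN0 _
  have hY0 : 0 < Y := by linarith
  have hYν : Y ≤ ν ^ 37 := by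
    have h1 : ν ^ 963 * Y ≤ ν ^ 963 * ν ^ 37 := by
      rw [← pow_add, hνN, ← hXY]
      exact mul_le_mul_of_nonneg_right hX hY0.le
    exact le_of_mul_le_mul_left h1 (by positivity)
  have hP : PP c N = ((10 : ℝ) ^ 9)⁻¹ * X := rfl
  have hP0 : 0 < PP c N := by rw [hP]; positivity
  have hνP : ν ^ 2 ≤ PP c N := by
    rw [hP, inv_mul_eq_div, le_div_iff₀ (by positivity)]
    calc ν ^ 2 * 10 ^ 9 ≤ ν ^ 2 * ν := by gcongr; linarith
      _ = ν ^ 3 := by ring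
      _ ≤ ν ^ 963 := pow_le_pow_right₀ hν1 (by norm_num)
      _ ≤ X := hX
  have h2P : 2 * PP c N ≤ X := by rw [hP]; linarith
  set R := ⌊ν⌋₊ with hR
  have hR1 : 1 ≤ R := Nat.le_floor (by exact_mod_cast hν1)
  have hRν : (R : ℝ) ≤ ν := Nat.floor_le hν0.le
  have hRP : R ≤ ⌊PP c N⌋₊ := by
    refine Nat.floor_le_floor ?_
    nlinarith
  set H := ⌊(d : ℝ) ^ 2 * Y / 24⌋₊ with hH
  have hdY : 48 ≤ (d : ℝ) ^ 2 * Y := by nlinarith [one_le_pow₀ hd1 (n := 2)]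
  have hH1 : 1 ≤ H := Nat.le_floor (by push_cast; linarith)
  have hHle : (H : ℝ) ≤ d ^ 2 * Y / 24 := Nat.floor_le (by positivity)
  have hHge : (d : ℝ) ^ 2 * Y / 48 ≤ H := by
    have := Nat.lt_floor_add_one ((d : ℝ) ^ 2 * Y / 24)
    linarith
  set C := 8 + 8 * B + (2 * B + 6) / A with hC
  have hC0 : 0 < C := by positivity
  set x : ℕ → ℝ := fun n => ((N : ℝ) - (n : ℝ) ^ c) ^ (1 / c) / (d : ℝ) ^ 2 with hx
  have hE : ∀ r, 1 ≤ r → r ≤ R ^ 2 → ∀ j : ℕ, 1 ≤ j → j < H →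
      ‖∑ n ∈ (Finset.Ioc ⌊PP c N⌋₊ ⌊2 * PP c N⌋₊).filter (fun n => r ∣ n), addExp (j * x n)‖ ≤
        C * (X / ν ^ 140) := by
    intro r hr1 hrR j hj1 hjH
    have hrν : (r : ℝ) ≤ ν ^ 2 := by
      have : (r : ℝ) ≤ (R : ℝ) ^ 2 := by exact_mod_cast hrR
      exact this.trans (by gcongr)
    have hr1' : (1 : ℝ) ≤ r := by exact_mod_cast hr1
    have hj1' : (1 : ℝ) ≤ j := by exact_mod_cast hj1
    have hjH' : (j : ℝ) ≤ H := by exact_mod_cast hjH.le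
    have e : ∀ n : ℕ, (j : ℝ) * x n = (j / (d : ℝ) ^ 2) * ((N : ℝ) - (n : ℝ) ^ c) ^ (1 / c) := by
      intro n; simp only [hx]; ring
    simp only [e]
    refine norm_sum_addExp_rpow_le_of_scale hc hA hAB h hN hr1 (hrν.trans hνP) hν1 hX ?_ ?_
    · have h1 : (d : ℝ) ^ 2 ≤ ν ^ 80 := by
        calc (d : ℝ) ^ 2 ≤ (ν ^ 40) ^ 2 := by gcongr
          _ = ν ^ 80 := by rw [← pow_mul]
      calc (1 : ℝ) = 1 / (d : ℝ) ^ 2 * 1 ^ 2 * d ^ 2 := by field_simp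
        _ ≤ j / (d : ℝ) ^ 2 * r ^ 2 * ν ^ 80 := by gcongr
    · have h1 : (j : ℝ) / d ^ 2 ≤ Y := by
        rw [div_le_iff₀ (by positivity)]
        nlinarith
      calc (j : ℝ) / d ^ 2 * r ^ 2 ≤ ν ^ 37 * (ν ^ 2) ^ 2 := by
            gcongr
            exact h1.trans hYν
        _ = ν ^ 41 := by rw [← pow_mul, ← pow_add]
  have hmain := card_primes_near_integers_le (Nat.floor_le_floor (by linarith)) hR1 hRP hH1
    (by positivity) hE
  set S := {p : ℕ | p ∈ Finset.Ioc ⌊PP c N⌋₊ ⌊2 * PP c N⌋₊ ∧ p.Prime ∧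
    ∃ k : ℤ, |x p - k| * (6 * H) ≤ 1} with hS
  have hsol : ∀ p ∈ primesIn c N, ∀ m : ℕ,
      ⌊(p : ℝ) ^ c⌋ + ⌊(m : ℝ) ^ c⌋ = (N : ℤ) →
      ((N : ℝ) - (p : ℝ) ^ c) ^ (1 / c) ≤ m ∧
        (m : ℝ) < ((N : ℝ) - (p : ℝ) ^ c) ^ (1 / c) + 4 / Y := by
    intro p hp m hm
    have := mem_Ico_of_floor_add_floor_eq hc hN (Finset.mem_filter.1 hp).2.2.2 hm
    rwa [hYinv, ← div_eq_mul_inv] at this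
  have h4Y : 4 / Y < 1 := by rw [div_lt_one hY0]; linarith
  have hcnt1 : ∀ p ∈ primesIn c N, cnt c N d p ≤ 1 := by
    intro p hp
    suffices hss : Set.Subsingleton {m : ℕ | 0 < m ∧ d ^ 2 ∣ m ∧
        ⌊(p : ℝ) ^ c⌋ + ⌊(m : ℝ) ^ c⌋ = (N : ℤ)} from
      (Set.ncard_le_one hss.finite).2 fun a ha b hb => hss ha hb
    rintro m ⟨_, _, hm⟩ m' ⟨_, _, hm'⟩
    have h1 := hsol p hp m hm
    have h2 := hsol p hp m' hm'
    have h3 : (m : ℝ) < m' + 1 := by linarith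
    have h4 : (m' : ℝ) < m + 1 := by linarith
    have h3' : m < m' + 1 := by exact_mod_cast h3
    have h4' : m' < m + 1 := by exact_mod_cast h4
    omega
  have hsub : (((primesIn c N).filter fun p => cnt c N d p ≠ 0 : Finset ℕ) : Set ℕ) ⊆ S := by
    intro p hp
    obtain ⟨hp, hne⟩ := Finset.mem_filter.1 (Finset.mem_coe.1 hp)
    obtain ⟨m, _, ⟨k, hk⟩, hm⟩ := Set.nonempty_of_ncard_ne_zero hne
    obtain ⟨-, hpp, hp1, hp2⟩ := Finset.mem_filter.1 hp
    refine ⟨Finset.mem_Ioc.2 ⟨(Nat.floor_lt hP0.le).2 hp1, Nat.le_floor hp2⟩, hpp, k, ?_⟩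
    obtain ⟨h1, h2⟩ := hsol p hp m hm
    have hmk : (m : ℝ) = d ^ 2 * k := by rw [hk]; push_cast; ring
    rw [hmk] at h1 h2
    have h3 : |x p - (k : ℤ)| ≤ 4 / Y / d ^ 2 := by
      have e : x p - ((k : ℤ) : ℝ) =
          (((N : ℝ) - (p : ℝ) ^ c) ^ (1 / c) - d ^ 2 * k) / d ^ 2 := by
        simp only [hx]; push_cast; field_simp
      rw [e, abs_div, abs_of_pos (by positivity : (0 : ℝ) < (d : ℝ) ^ 2)]
      gcongr
      rw [abs_le]
      constructor <;> linarith [show 0 < 4 / Y by positivity]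
    calc |x p - (k : ℤ)| * (6 * H) ≤ 4 / Y / d ^ 2 * (6 * (d ^ 2 * Y / 24)) := by gcongr
      _ = 1 := by field_simp; norm_num
  have hSfin : S.Finite := (Finset.finite_toSet (Finset.Ioc ⌊PP c N⌋₊ ⌊2 * PP c N⌋₊)).subset
    fun p hp => hp.1
  have hlog0 : 0 ≤ Real.log N := Real.log_nonneg (by exact_mod_cast hN)
  have hsum : ∑ p ∈ primesIn c N, Real.log p * (cnt c N d p : ℝ) ≤ Real.log N * S.ncard := by
    have hcard : (((primesIn c N).filter fun p => cnt c N d p ≠ 0).card : ℝ) ≤ S.ncard := by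
      rw [← Set.ncard_coe_finset]
      exact_mod_cast Set.ncard_le_ncard hsub hSfin
    calc ∑ p ∈ primesIn c N, Real.log p * (cnt c N d p : ℝ)
        ≤ ∑ p ∈ primesIn c N, if cnt c N d p ≠ 0 then Real.log N else 0 := by
          refine Finset.sum_le_sum fun p hp => ?_
          split_ifs with hne
          · obtain ⟨hpN, hpp, -⟩ := Finset.mem_filter.1 hp
            have h1 : Real.log p ≤ Real.log N :=
              Real.log_le_log (by exact_mod_cast hpp.pos)
                (by exact_mod_cast Nat.lt_succ_iff.1 (Finset.mem_range.1 hpN))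
            have h2 : (cnt c N d p : ℝ) ≤ 1 := by exact_mod_cast hcnt1 p hp
            calc Real.log p * (cnt c N d p : ℝ) ≤ Real.log N * 1 := by gcongr
              _ = _ := mul_one _
          · simp [not_not.1 hne]
      _ = Real.log N * ((primesIn c N).filter fun p => cnt c N d p ≠ 0).card := by
          rw [← Finset.sum_filter, Finset.sum_const, nsmul_eq_mul, mul_comm]
      _ ≤ _ := by gcongr
  refine hsum.trans ?_
  have hlogR : Real.log N / 1000 ≤ Real.log (R + 1) := by
    have e : Real.log N = 1000 * Real.log ν := by
      rw [← hνN, Real.log_pow]; norm_num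
    rw [e, mul_div_cancel_left₀ _ (by norm_num)]
    exact Real.log_le_log hν0 (Nat.lt_floor_add_one ν).le
  have hlogR0 : 0 < Real.log ((R : ℝ) + 1) :=
    Real.log_pos (by have : (1 : ℝ) ≤ R := by exact_mod_cast hR1
                     linarith)
  have hlen : (⌊2 * PP c N⌋₊ : ℝ) - ⌊PP c N⌋₊ ≤ X := by
    have h1 := Nat.floor_le (by positivity : 0 ≤ 2 * PP c N)
    have h2 : (0 : ℝ) ≤ ⌊PP c N⌋₊ := Nat.cast_nonneg _
    linarith
  have hR6 : (R : ℝ) ^ 6 ≤ ν ^ 6 := by gcongr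
  have k1 : Real.log N * (((⌊2 * PP c N⌋₊ : ℝ) - ⌊PP c N⌋₊) * (2 / Real.log (R + 1))) ≤
      2000 * X := by
    have e : Real.log N * (2 / Real.log (R + 1)) ≤ 2000 := by
      rw [mul_div_assoc', div_le_iff₀ hlogR0]
      linarith
    calc _ = ((⌊2 * PP c N⌋₊ : ℝ) - ⌊PP c N⌋₊) * (Real.log N * (2 / Real.log (R + 1))) := by ring
      _ ≤ X * 2000 := by gcongr
      _ = _ := mul_comm _ _
  have k2 : Real.log N * (R : ℝ) ^ 6 ≤ X := by
    calc Real.log N * (R : ℝ) ^ 6 ≤ ν * ν ^ 6 := by gcongr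
      _ = ν ^ 7 := by ring
      _ ≤ ν ^ 963 := pow_le_pow_right₀ hν1 (by norm_num)
      _ ≤ X := hX
  have k3 : 4 / (H : ℝ) ≤ 192 / (d ^ 2 * Y) := by
    calc 4 / (H : ℝ) ≤ 4 / ((d : ℝ) ^ 2 * Y / 48) := by gcongr
      _ = _ := by field_simp; norm_num
  have k4 : Real.log N * (R : ℝ) ^ 6 * (X / ν ^ 140) ≤ X / (d ^ 2 * Y) := by
    have h1 : (d : ℝ) ^ 2 * Y ≤ ν ^ 117 := by
      calc (d : ℝ) ^ 2 * Y ≤ (ν ^ 40) ^ 2 * ν ^ 37 := by gcongr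
        _ = ν ^ 117 := by rw [← pow_mul, ← pow_add]
    calc Real.log N * (R : ℝ) ^ 6 * (X / ν ^ 140) ≤ ν * ν ^ 6 * (X / ν ^ 140) := by gcongr
      _ = X / ν ^ 133 := by field_simp
      _ ≤ X / ν ^ 117 := by
          gcongr
          norm_num
      _ ≤ _ := by gcongr
  calc Real.log N * (S.ncard : ℝ) ≤ Real.log N * (4 / H * (((⌊2 * PP c N⌋₊ : ℝ) - ⌊PP c N⌋₊) *
        (2 / Real.log (R + 1)) + (R : ℝ) ^ 6) + 4 * (R : ℝ) ^ 6 * (C * (X / ν ^ 140))) := by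
        gcongr
    _ = 4 / H * (Real.log N * (((⌊2 * PP c N⌋₊ : ℝ) - ⌊PP c N⌋₊) * (2 / Real.log (R + 1))) +
        Real.log N * (R : ℝ) ^ 6) + 4 * C * (Real.log N * (R : ℝ) ^ 6 * (X / ν ^ 140)) := by ring
    _ ≤ 192 / (d ^ 2 * Y) * (2000 * X + X) + 4 * C * (X / (d ^ 2 * Y)) := by
        refine add_le_add ?_ (mul_le_mul_of_nonneg_left k4 (by positivity))
        refine (mul_le_mul_of_nonneg_left (add_le_add k1 k2) (by positivity)).trans ?_
        exact mul_le_mul_of_nonneg_right k3 (by positivity)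
    _ = _ := by
        rw [hXdY]
        field_simp
        ring

/-- Suppose that `1 < c < 82/79` and `γ = 1/c`.  Then there exists a constant `C > 0`
such that `|Γ₂| ≤ C · N^(2γ-1) D⁻¹` for all sufficiently large `N`, where `D = log N`. -/
theorem Gamma2_upper_bound (c : ℝ) (hc1 : 1 < c) (hc2 : c < 82 / 79) :
    ∃ C : ℝ, 0 < C ∧ ∃ N₀ : ℕ, ∀ N : ℕ, N₀ ≤ N →
      |Γ₂ c N| ≤ C * (N : ℝ) ^ (2 * (1 / c) - 1) * (Real.log N)⁻¹ := by
  have hc0 : 0 < c := by linarith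
  obtain ⟨A, B, hA, hAB, hsd⟩ := exists_second_difference_bounds hc1
    (u := ((10 : ℝ) ^ 9)⁻¹) (v := 3 * ((10 : ℝ) ^ 9)⁻¹) (by norm_num) (by norm_num) (by norm_num)
  have hB : 0 < B := hA.trans_le hAB
  set K := 384192 + 4 * (8 + 8 * B + (2 * B + 6) / A) with hK
  have hK0 : 0 < K := by positivity
  have hγ : 963 / 1000 < 1 / c := by
    rw [lt_div_iff₀ hc0]; linarith
  have hγ1 : 0 < 1 - 1 / c := by
    rw [sub_pos, div_lt_one hc0]; exact hc1
  have hev : ∀ᶠ N : ℕ in Filter.atTop, 3 ≤ N ∧ (10 : ℝ) ^ 10 ≤ (N : ℝ) ^ (1 / 1000 : ℝ) ∧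
      Real.log N ≤ (N : ℝ) ^ (1 / 1000 : ℝ) ∧ 48 ≤ (N : ℝ) ^ (1 - 1 / c) := by
    have hcast := tendsto_natCast_atTop_atTop (R := ℝ)
    have e1 := hcast.eventually
      ((tendsto_rpow_atTop (by norm_num : (0 : ℝ) < 1 / 1000)).eventually_ge_atTop ((10 : ℝ) ^ 10))
    have e2 := hcast.eventually
      ((isLittleO_log_rpow_atTop (by norm_num : (0 : ℝ) < 1 / 1000)).bound one_pos)
    have e3 := hcast.eventually ((tendsto_rpow_atTop hγ1).eventually_ge_atTop 48)
    filter_upwards [Filter.eventually_ge_atTop 3, e1, e2, e3] with N h0 h1 h2 h3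
    refine ⟨h0, h1, ?_, h3⟩
    rw [one_mul, Real.norm_of_nonneg (by positivity : (0 : ℝ) ≤ (N : ℝ) ^ (1 / 1000 : ℝ))] at h2
    exact (le_abs_self _).trans h2
  obtain ⟨N₀, hN₀⟩ := Filter.eventually_atTop.1 hev
  refine ⟨2 * K + 4, by positivity, N₀, fun N hNN => ?_⟩
  obtain ⟨hN3, hν, hL, hY⟩ := hN₀ N hNN
  have hN : 1 ≤ N := by omega
  have hN0 : (0 : ℝ) < N := by exact_mod_cast hN
  have hN1 : (1 : ℝ) ≤ N := by exact_mod_cast hN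
  have hνN : ((N : ℝ) ^ (1 / 1000 : ℝ)) ^ 1000 = N := by
    rw [← Real.rpow_natCast, ← Real.rpow_mul hN0.le]; norm_num
  have hX : ((N : ℝ) ^ (1 / 1000 : ℝ)) ^ 963 ≤ (N : ℝ) ^ (1 / c) := by
    rw [← Real.rpow_natCast, ← Real.rpow_mul hN0.le]
    exact Real.rpow_le_rpow_of_exponent_le hN1 (by push_cast; linarith)
  have hYν : (N : ℝ) ^ (1 - 1 / c) ≤ ((N : ℝ) ^ (1 / 1000 : ℝ)) ^ 37 := by
    rw [← Real.rpow_natCast, ← Real.rpow_mul hN0.le]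
    exact Real.rpow_le_rpow_of_exponent_le hN1 (by push_cast; linarith)
  have hXdY : (N : ℝ) ^ (2 * (1 / c) - 1) = (N : ℝ) ^ (1 / c) / (N : ℝ) ^ (1 - 1 / c) := by
    rw [← Real.rpow_sub hN0]; congr 1; ring
  have hL0 : 0 < Real.log N := Real.log_pos (by exact_mod_cast (by omega : 1 < N))
  set ν := (N : ℝ) ^ (1 / 1000 : ℝ) with hνdef
  have hν0 : 0 < ν := by linarith
  set X := (N : ℝ) ^ (1 / c) with hXdef
  set Y := (N : ℝ) ^ (1 - 1 / c) with hYdef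
  set M := (N : ℝ) ^ (2 * (1 / c) - 1) with hM
  have hM0 : 0 < M := Real.rpow_pos_of_pos hN0 _
  have hX0 : 0 < X := Real.rpow_pos_of_pos hN0 _
  have hY0 : 0 < Y := by linarith
  set g : ℝ → ℕ → ℝ := fun t d => if t < (d : ℝ) then 1 / (d : ℝ) ^ 2 else 0 with hg
  have hg0 : ∀ t d, 0 ≤ g t d := fun t d => by simp only [hg]; split_ifs <;> positivity
  have hterm0 : ∀ d, 0 ≤ ∑ p ∈ primesIn c N, Real.log p * (cnt c N d p : ℝ) := fun d =>
    Finset.sum_nonneg fun p _ => mul_nonneg (Real.log_natCast_nonneg p) (Nat.cast_nonneg _)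
  have hbound : ∀ d : ℕ, ‖(if 0 < d ∧ Real.log N < (d : ℝ) then
      ((ArithmeticFunction.moebius d : ℤ) : ℝ) *
        ∑ p ∈ primesIn c N, Real.log p * (cnt c N d p : ℝ) else 0)‖ ≤
      K * M * g (Real.log N) d + 2 * X * Real.log N * g (ν ^ 40) d := by
    intro d
    have hr1 : 0 ≤ K * M * g (Real.log N) d := mul_nonneg (by positivity) (hg0 _ _)
    have hr2 : 0 ≤ 2 * X * Real.log N * g (ν ^ 40) d := mul_nonneg (by positivity) (hg0 _ _)
    split_ifs with hd
    · have hmu : |((ArithmeticFunction.moebius d : ℤ) : ℝ)| ≤ 1 := by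
        exact_mod_cast ArithmeticFunction.abs_moebius_le_one
      rw [norm_mul, Real.norm_eq_abs, Real.norm_of_nonneg (hterm0 d)]
      refine (mul_le_of_le_one_left (hterm0 d) hmu).trans ?_
      rcases le_or_gt (d : ℝ) (ν ^ 40) with hdν | hdν
      · have h1 := sum_log_mul_cnt_le hc1 hA hAB hsd hN hd.1 hν hνN hL hX hY hdν
        have h2 : g (Real.log N) d = 1 / (d : ℝ) ^ 2 := if_pos hd.2
        rw [h2] at hr1 ⊢
        calc _ ≤ K * M / d ^ 2 := h1
          _ = K * M * (1 / d ^ 2) := by ring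
          _ ≤ _ := by linarith
      · have h2 : g (ν ^ 40) d = 1 / (d : ℝ) ^ 2 := if_pos hdν
        have h3 := sum_cnt_le hc1 hN hd.1
        rw [h2] at hr2 ⊢
        calc ∑ p ∈ primesIn c N, Real.log p * (cnt c N d p : ℝ)
            ≤ ∑ p ∈ primesIn c N, Real.log N * (cnt c N d p : ℝ) := by
              refine Finset.sum_le_sum fun p hp => ?_
              obtain ⟨hpN, hpp, -⟩ := Finset.mem_filter.1 hp
              exact mul_le_mul_of_nonneg_right (Real.log_le_log (by exact_mod_cast hpp.pos)
                (by exact_mod_cast Nat.lt_succ_iff.1 (Finset.mem_range.1 hpN)))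
                (Nat.cast_nonneg _)
          _ = Real.log N * ∑ p ∈ primesIn c N, (cnt c N d p : ℝ) := by rw [Finset.mul_sum]
          _ ≤ Real.log N * (2 * X / d ^ 2) := by gcongr
          _ = 2 * X * Real.log N * (1 / d ^ 2) := by ring
          _ ≤ _ := by linarith
    · rw [norm_zero]; linarith
  have hs1 := (summable_ite_inv_sq hL0).hasSum.mul_left (K * M)
  have hs2 := (summable_ite_inv_sq (by positivity : 0 < ν ^ 40)).hasSum.mul_left
    (2 * X * Real.log N)
  have hfin := tsum_of_norm_bounded (hs1.add hs2) hbound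
  rw [Real.norm_eq_abs] at hfin
  have ht1 := tsum_ite_inv_sq_le hL0
  have ht2 := tsum_ite_inv_sq_le (by positivity : 0 < ν ^ 40)
  have hlast : X * Real.log N / ν ^ 40 ≤ M * (Real.log N)⁻¹ := by
    rw [hXdY, div_mul_eq_mul_div, div_le_div_iff₀ (by positivity) hY0]
    calc X * Real.log N * Y = X * (Real.log N)⁻¹ * (Real.log N * Real.log N * Y) := by
          field_simp
      _ ≤ X * (Real.log N)⁻¹ * (ν * ν * ν ^ 37) := by gcongr
      _ = X * (Real.log N)⁻¹ * ν ^ 39 := by ring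
      _ ≤ X * (Real.log N)⁻¹ * ν ^ 40 := by
          gcongr
          · linarith
          · norm_num
  calc |Γ₂ c N| ≤ _ := hfin
    _ ≤ K * M * (2 / Real.log N) + 2 * X * Real.log N * (2 / ν ^ 40) := by gcongr
    _ = 2 * K * (M * (Real.log N)⁻¹) + 4 * (X * Real.log N / ν ^ 40) := by ring
    _ ≤ 2 * K * (M * (Real.log N)⁻¹) + 4 * (M * (Real.log N)⁻¹) := by gcongr
    _ = _ := by ring
end

section
/- Suppose that 1 < c < 82/79 and set γ = 1/c. For a positive integer N put P = 10⁻⁹ N^γ, D = log N, and Γ₃ = Σ_{d ≤ D} (μ(d)/d²) Σ_{P < p ≤ 2P} ((N + 1 − [p^c])^γ − (N − [p^c])^γ) log p, where p runs over primes. Then there exist a constant C > 0 and N₀ such that Γ₃ ≥ C · N^{2γ−1} for all integers N ≥ N₀. -/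
/-- `Γ₃ = Σ_{d ≤ D} (μ(d)/d²) Σ_{P < p ≤ 2P} ((N+1-[p^c])^γ - (N-[p^c])^γ) log p`,
with `D = log N` and `γ = 1/c`. -/
noncomputable def Γ₃ (c : ℝ) (N : ℕ) : ℝ :=
  ∑ d ∈ Finset.Icc 1 ⌊Real.log N⌋₊,
    (((ArithmeticFunction.moebius d : ℤ) : ℝ) / (d : ℝ) ^ 2) *
      ∑ p ∈ primesIn c N,
        (((N : ℝ) + 1 - (⌊(p : ℝ) ^ c⌋ : ℝ)) ^ (1 / c)
            - ((N : ℝ) - (⌊(p : ℝ) ^ c⌋ : ℝ)) ^ (1 / c)) * Real.log p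

open Finset in
/-- The central binomial coefficient is bounded by the contribution of its small primes times the
product of the primes in `(n, 2n]`. -/
theorem centralBinom_le_mul_prod_primes (n : ℕ) (hn : 2 < n) :
    n.centralBinom ≤ (2 * n) ^ Nat.sqrt (2 * n) * 4 ^ (2 * n / 3) *
      ∏ p ∈ Ioc n (2 * n) with p.Prime, p := by
  have n2_pos : 1 ≤ 2 * n := by lia
  let f x := x ^ n.centralBinom.factorization x
  let A := {p ∈ Icc 1 (Nat.sqrt (2 * n)) | p.Prime}
  let B := {p ∈ range (2 * n / 3 + 1) | p.Prime ∧ Nat.sqrt (2 * n) < p}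
  let C := {p ∈ Ioc n (2 * n) | p.Prime}
  have f_one (p : ℕ) (hp : p.Prime) : 1 ≤ f p := Nat.one_le_pow _ _ hp.pos
  have f_le (p : ℕ) (hp : p.Prime) (h : Nat.sqrt (2 * n) < p) : f p ≤ p :=
    (pow_right_mono₀ hp.one_lt.le (Nat.factorization_choose_le_one (Nat.sqrt_lt'.mp h))).trans
      (pow_one p).le
  have hsqrt : Nat.sqrt (2 * n) ≤ n := Nat.le_of_lt_succ (Nat.sqrt_lt'.2 (by nlinarith))
  have hsub : ∏ p ∈ range (2 * n + 1), f p ≤ ∏ p ∈ (A ∪ B) ∪ C, f p := by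
    have hprime : ∀ p ∈ (A ∪ B) ∪ C, p.Prime := by
      intro p hp
      simp only [A, B, C, mem_union, mem_filter] at hp
      tauto
    have h1 : ∏ p ∈ range (2 * n + 1) with p ∈ (A ∪ B) ∪ C, f p = ∏ p ∈ range (2 * n + 1), f p := by
      refine prod_filter_of_ne fun p hp h => ?_
      contrapose! h
      simp only [A, B, C, mem_union, mem_filter, mem_Icc, mem_Ioc, mem_range] at h hp
      by_cases hpp : p.Prime
      · have := hpp.pos
        have : n.centralBinom.factorization p = 0 :=
          Nat.factorization_centralBinom_of_two_mul_self_lt_three_mul hn (by grind) (by grind)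
        simp [f, this]
      · simp [f, Nat.factorization_eq_zero_of_not_prime _ hpp]
    rw [← h1]
    exact prod_le_prod_of_subset_of_one_le' (fun p hp => (mem_filter.1 hp).2)
      fun p hp _ => f_one p (hprime p hp)
  have hunion : ∏ p ∈ (A ∪ B) ∪ C, f p = (∏ p ∈ A, f p) * (∏ p ∈ B, f p) * ∏ p ∈ C, f p := by
    rw [prod_union, prod_union]
    · rw [disjoint_left]
      grind
    · rw [disjoint_left]
      grind
  rw [← n.prod_pow_factorization_centralBinom]
  refine hsub.trans (hunion.trans_le ?_)
  gcongr ?_ * ?_ * ?_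
  · refine (prod_le_pow_card A f (2 * n) fun p _ =>
      Nat.pow_factorization_choose_le (by lia)).trans ?_
    exact pow_right_mono₀ n2_pos ((card_filter_le _ _).trans (by simp))
  · refine le_trans ?_ (primorial_le_four_pow (2 * n / 3))
    refine (prod_le_prod' fun p hp => f_le p (mem_filter.1 hp).2.1 (mem_filter.1 hp).2.2).trans ?_
    refine prod_le_prod_of_subset_of_one_le' (fun p hp => ?_) fun p hp _ =>
      (mem_filter.1 hp).2.one_lt.le
    simp only [B, mem_filter] at hp ⊢
    exact ⟨hp.1, hp.2.1⟩
  · refine prod_le_prod' fun p hp => ?_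
    simp only [C, mem_filter, mem_Ioc] at hp
    exact f_le p hp.2 (by lia)

open Finset Filter in
/-- A Chebyshev-type lower bound for the primes in `(n, 2n]`. -/
theorem eventually_le_sum_log_primes_Ioc :
    ∀ᶠ n : ℕ in atTop, (n : ℝ) / 4 ≤ ∑ p ∈ Ioc n (2 * n) with p.Prime, Real.log p := by
  have hlog : ∀ᶠ y : ℝ in atTop, ‖Real.log y‖ ≤ 1 / 100 * ‖y ^ (1 / 2 : ℝ)‖ :=
    (isLittleO_log_rpow_atTop (by norm_num)).bound (by norm_num)
  have hcast : Tendsto (fun n : ℕ => 2 * (n : ℝ)) atTop atTop :=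
    tendsto_natCast_atTop_atTop.const_mul_atTop (by norm_num)
  filter_upwards [hcast.eventually hlog, eventually_ge_atTop 4] with n hn hn4
  have hn4' : (4 : ℝ) ≤ n := by exact_mod_cast hn4
  set y : ℝ := 2 * n with hy
  rw [← Real.sqrt_eq_rpow, Real.norm_of_nonneg (Real.log_nonneg (by linarith)),
    Real.norm_of_nonneg (Real.sqrt_nonneg _)] at hn
  have hprod : 4 ^ n ≤ n * ((2 * n) ^ Nat.sqrt (2 * n) * 4 ^ (2 * n / 3) *
      ∏ p ∈ Ioc n (2 * n) with p.Prime, p) :=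
    (Nat.four_pow_lt_mul_centralBinom n hn4).le.trans
      (Nat.mul_le_mul_left n (centralBinom_le_mul_prod_primes n (by lia)))
  have hprod' : (4 : ℝ) ^ n ≤ n * (y ^ Nat.sqrt (2 * n) * 4 ^ (2 * n / 3) *
      ∏ p ∈ Ioc n (2 * n) with p.Prime, (p : ℝ)) := by
    have h := Nat.cast_le (α := ℝ).2 hprod
    push_cast at h
    exact h
  have hne : ∀ p ∈ {p ∈ Ioc n (2 * n) | p.Prime}, (p : ℝ) ≠ 0 := fun p hp =>
    Nat.cast_ne_zero.2 (mem_filter.1 hp).2.ne_zero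
  have hkey := Real.log_le_log (by positivity) hprod'
  have hprod_ne := prod_ne_zero_iff.2 hne
  rw [Real.log_mul (by positivity) (by positivity), Real.log_mul (by positivity) hprod_ne,
    Real.log_mul (by positivity) (by positivity), Real.log_pow, Real.log_pow, Real.log_pow,
    Real.log_prod hne] at hkey
  have hlog4 : 1.38 < Real.log 4 := by
    rw [show (4 : ℝ) = 2 ^ 2 by norm_num, Real.log_pow]
    have := Real.log_two_gt_d9
    norm_num at this ⊢
    linarith
  have hlogy : 0 ≤ Real.log y := Real.log_nonneg (by linarith)
  have hlogn : Real.log n ≤ Real.log y := Real.log_le_log (by linarith) (by linarith)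
  have hsq : √y * √y = y := Real.mul_self_sqrt (by linarith)
  have hs1 : 1 ≤ √y := Real.one_le_sqrt.2 (by linarith)
  have hsqrt : (Nat.sqrt (2 * n) : ℝ) ≤ √y := by
    have := Real.nat_sqrt_le_real_sqrt (a := 2 * n)
    simpa [hy] using this
  have hmul : (Nat.sqrt (2 * n) : ℝ) * Real.log y ≤ √y * (1 / 100 * √y) := by gcongr
  have hdiv : ((2 * n / 3 : ℕ) : ℝ) ≤ 2 * n / 3 := by
    refine Nat.cast_div_le.trans ?_
    norm_num
  have hdiv4 : ((2 * n / 3 : ℕ) : ℝ) * Real.log 4 ≤ 2 * n / 3 * Real.log 4 := by gcongr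
  nlinarith

/-- The partial sums of `∑ μ(d) / d²` are bounded below by `1 / 4`. -/
theorem quarter_le_sum_moebius_div_sq {D : ℕ} (hD : 1 ≤ D) :
    (1 / 4 : ℝ) ≤ ∑ d ∈ Finset.Icc 1 D,
      ((ArithmeticFunction.moebius d : ℤ) : ℝ) / (d : ℝ) ^ 2 := by
  have hstep (d : ℕ) : -(1 / (d : ℝ) ^ 2) ≤
      ((ArithmeticFunction.moebius d : ℤ) : ℝ) / (d : ℝ) ^ 2 := by
    rw [← neg_div]
    gcongr
    have := (abs_le.1 (ArithmeticFunction.abs_moebius_le_one (n := d))).1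
    exact_mod_cast this
  obtain rfl | hD2 := hD.eq_or_lt
  · norm_num
  suffices h : (1 / 4 + 1 / D : ℝ) ≤ ∑ d ∈ Finset.Icc 1 D,
      ((ArithmeticFunction.moebius d : ℤ) : ℝ) / (d : ℝ) ^ 2 from
    (le_add_of_nonneg_right (by positivity)).trans h
  induction D, hD2 using Nat.le_induction with
  | base =>
    have := hstep 2
    rw [Finset.sum_Icc_succ_top (by norm_num)]
    norm_num at this ⊢
    linarith
  | succ n hn ih =>
    rw [Finset.sum_Icc_succ_top (by lia)]
    have h1 := ih (by lia)
    have h2 := hstep (n + 1)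
    have hn0 : (0 : ℝ) < n := by exact_mod_cast (by lia : 0 < n)
    have h3 : (1 / ((n + 1 : ℕ) : ℝ)) + 1 / ((n + 1 : ℕ) : ℝ) ^ 2 ≤ 1 / n := by
      push_cast
      rw [div_add_div _ _ (by positivity) (by positivity), div_le_div_iff₀ (by positivity) hn0]
      nlinarith
    linarith

/-- Lower bound for the increment of `x ↦ x ^ γ`, for `0 ≤ γ ≤ 1`. -/
theorem mul_rpow_sub_one_le_rpow_sub_rpow {γ x : ℝ} (hγ0 : 0 ≤ γ) (hγ1 : γ ≤ 1) (hx : 0 ≤ x) :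
    γ * (x + 1) ^ (γ - 1) ≤ (x + 1) ^ γ - x ^ γ := by
  have hx1 : 0 < x + 1 := by linarith
  have hinv : 1 / (x + 1) ≤ 1 := by
    rw [div_le_one hx1]
    linarith
  have hb : (1 + -(1 / (x + 1))) ^ γ ≤ 1 + γ * -(1 / (x + 1)) :=
    rpow_one_add_le_one_add_mul_self (by linarith) hγ0 hγ1
  have hxe : x = (x + 1) * (1 + -(1 / (x + 1))) := by
    field_simp
    ring
  have hxp : x ^ γ = (x + 1) ^ γ * (1 + -(1 / (x + 1))) ^ γ := by
    conv_lhs => rw [hxe]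
    exact Real.mul_rpow hx1.le (by linarith)
  have hpos : 0 ≤ (x + 1) ^ γ := by positivity
  rw [hxp, Real.rpow_sub_one hx1.ne']
  have := mul_le_mul_of_nonneg_left hb hpos
  have he : γ * ((x + 1) ^ γ / (x + 1)) = (x + 1) ^ γ * (γ * (1 / (x + 1))) := by ring
  rw [he]
  linarith

/-- For `p ≤ 2P`, each increment in `Γ₃` is at least `(γ / 2) N^(γ - 1)`. -/
theorem half_mul_rpow_le_increment {c : ℝ} (hc : 1 < c) {N p : ℕ} (hN : 1 ≤ N)
    (hp : (p : ℝ) ≤ 2 * PP c N) :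
    1 / c / 2 * (N : ℝ) ^ (1 / c - 1) ≤
      ((N : ℝ) + 1 - (⌊(p : ℝ) ^ c⌋ : ℝ)) ^ (1 / c)
        - ((N : ℝ) - (⌊(p : ℝ) ^ c⌋ : ℝ)) ^ (1 / c) := by
  have hc0 : 0 < c := by linarith
  have hN1 : (1 : ℝ) ≤ N := by exact_mod_cast hN
  have hγ0 : 0 < 1 / c := by positivity
  have hγ1 : 1 / c ≤ 1 := by
    rw [div_le_one hc0]
    exact hc.le
  have hpc : (p : ℝ) ^ c ≤ N := by
    have hle : (p : ℝ) ≤ (N : ℝ) ^ (1 / c) := by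
      have : 0 ≤ (N : ℝ) ^ (1 / c) := by positivity
      unfold PP at hp
      norm_num at hp this ⊢
      linarith
    calc (p : ℝ) ^ c ≤ ((N : ℝ) ^ (1 / c)) ^ c := by gcongr
      _ = N := by
        rw [← Real.rpow_mul (by positivity), one_div_mul_cancel hc0.ne', Real.rpow_one]
  have hfl0 : (0 : ℝ) ≤ (⌊(p : ℝ) ^ c⌋ : ℝ) := by
    exact_mod_cast Int.floor_nonneg.2 (by positivity)
  have hfl : (⌊(p : ℝ) ^ c⌋ : ℝ) ≤ N := (Int.floor_le _).trans hpc
  rw [add_sub_right_comm]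
  set x : ℝ := N - (⌊(p : ℝ) ^ c⌋ : ℝ)
  have hx : 0 ≤ x := by linarith
  refine le_trans ?_ (mul_rpow_sub_one_le_rpow_sub_rpow hγ0.le hγ1 hx)
  rw [div_mul_eq_mul_div, mul_div_assoc]
  gcongr
  calc (N : ℝ) ^ (1 / c - 1) / 2 ≤ 2 ^ (1 / c - 1) * (N : ℝ) ^ (1 / c - 1) := by
        have h2 : (2 : ℝ) ^ (-1 : ℝ) ≤ 2 ^ (1 / c - 1) :=
          Real.rpow_le_rpow_of_exponent_le (by norm_num) (by linarith)
        rw [Real.rpow_neg_one] at h2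
        rw [div_eq_inv_mul]
        gcongr
    _ = (2 * N : ℝ) ^ (1 / c - 1) := (Real.mul_rpow (by norm_num) (by positivity)).symm
    _ ≤ (x + 1) ^ (1 / c - 1) :=
        Real.rpow_le_rpow_of_nonpos (by linarith) (by linarith) (by linarith)

open Filter in
/-- A Chebyshev-type lower bound for the primes `P < p ≤ 2P`. -/
theorem eventually_le_sum_log_primesIn {c : ℝ} (hc : 1 < c) :
    ∀ᶠ N : ℕ in atTop, PP c N / 8 ≤ ∑ p ∈ primesIn c N, Real.log p := by
  have hc0 : 0 < c := by linarith
  have hP : Tendsto (fun N : ℕ => PP c N) atTop atTop :=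
    ((tendsto_rpow_atTop (by positivity)).comp tendsto_natCast_atTop_atTop).const_mul_atTop
      (by positivity)
  have hn := (tendsto_nat_floor_atTop.comp hP).eventually eventually_le_sum_log_primes_Ioc
  filter_upwards [hn, hP.eventually_ge_atTop 2, eventually_ge_atTop 1] with N hN hP2 hN1
  simp only [Function.comp_apply] at hN
  have hlt := Nat.lt_floor_add_one (PP c N)
  have hle := Nat.floor_le (by linarith : 0 ≤ PP c N)
  set n := ⌊PP c N⌋₊
  have hPN : 2 * PP c N ≤ N := by
    have hN1' : (1 : ℝ) ≤ N := by exact_mod_cast hN1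
    have : (N : ℝ) ^ (1 / c) ≤ (N : ℝ) ^ (1 : ℝ) :=
      Real.rpow_le_rpow_of_exponent_le hN1' (by rw [div_le_one hc0]; exact hc.le)
    rw [Real.rpow_one] at this
    unfold PP
    norm_num at this ⊢
    linarith
  refine le_trans (by linarith) (hN.trans (Finset.sum_le_sum_of_subset_of_nonneg ?_ ?_))
  · intro p hp
    simp only [Finset.mem_filter, Finset.mem_Ioc, primesIn, Finset.mem_range] at hp ⊢
    have h1 : (n : ℝ) + 1 ≤ p := by exact_mod_cast hp.1.1
    have h2 : (p : ℝ) ≤ 2 * n := by exact_mod_cast hp.1.2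
    have h3 : (p : ℝ) ≤ N := by linarith
    exact ⟨Nat.lt_succ_of_le (by exact_mod_cast h3), hp.2, by linarith, by linarith⟩
  · exact fun p _ _ => Real.log_natCast_nonneg p

/-- Suppose that `1 < c < 82/79` and `γ = 1/c`.  Then there exist a constant `C > 0`
and `N₀` such that `Γ₃ ≥ C · N^(2γ-1)` for all integers `N ≥ N₀`. -/
theorem Gamma3_lower_bound (c : ℝ) (hc1 : 1 < c) (hc2 : c < 82 / 79) :
    ∃ C : ℝ, 0 < C ∧ ∃ N₀ : ℕ, ∀ N : ℕ, N₀ ≤ N →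
      C * (N : ℝ) ^ (2 * (1 / c) - 1) ≤ Γ₃ c N := by
  have hc0 : 0 < c := by linarith
  refine ⟨1 / 4 * (1 / c / 2 * (((10 : ℝ) ^ 9)⁻¹ / 8)), by positivity, ?_⟩
  obtain ⟨N₁, hN₁⟩ := Filter.eventually_atTop.1 (eventually_le_sum_log_primesIn hc1)
  refine ⟨max N₁ 3, fun N hN => ?_⟩
  have hsum := hN₁ N ((le_max_left _ _).trans hN)
  have hN3 : 3 ≤ N := (le_max_right _ _).trans hN
  have hN3' : (3 : ℝ) ≤ N := by exact_mod_cast hN3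
  have hD : 1 ≤ ⌊Real.log N⌋₊ := by
    refine Nat.le_floor ?_
    rw [Nat.cast_one, Real.le_log_iff_exp_le (by linarith)]
    linarith [Real.exp_one_lt_d9]
  have hinner : 1 / c / 2 * (N : ℝ) ^ (1 / c - 1) * (PP c N / 8) ≤ ∑ p ∈ primesIn c N,
      (((N : ℝ) + 1 - (⌊(p : ℝ) ^ c⌋ : ℝ)) ^ (1 / c)
        - ((N : ℝ) - (⌊(p : ℝ) ^ c⌋ : ℝ)) ^ (1 / c)) * Real.log p := by
    refine (mul_le_mul_of_nonneg_left hsum (by positivity)).trans ?_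
    rw [Finset.mul_sum]
    refine Finset.sum_le_sum fun p hp => ?_
    simp only [primesIn, Finset.mem_filter] at hp
    exact mul_le_mul_of_nonneg_right (half_mul_rpow_le_increment hc1 (by lia) hp.2.2.2)
      (Real.log_natCast_nonneg p)
  have hpow : (N : ℝ) ^ (2 * (1 / c) - 1) = (N : ℝ) ^ (1 / c - 1) * (N : ℝ) ^ (1 / c) := by
    rw [← Real.rpow_add (by linarith)]
    ring_nf
  have hP0 : 0 ≤ PP c N := by
    unfold PP
    positivity
  unfold Γ₃
  rw [← Finset.sum_mul]
  calc _ = 1 / 4 * (1 / c / 2 * (N : ℝ) ^ (1 / c - 1) * (PP c N / 8)) := by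
        rw [hpow, PP]
        ring
    _ ≤ _ := mul_le_mul (quarter_le_sum_moebius_div_sq hD) hinner (by positivity)
        (le_trans (by norm_num) (quarter_le_sum_moebius_div_sq hD))
end
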